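/- arXiv:1607.02848 — 3 statements merged into one kernel-verified Lean document; each statement's English description precedes it below -/
import Mathlib

section
/- Let n ≥ 3 and let P be the spherical averaging projection Pf(x) = (1/ω_n) ∫_{S^{n-1}} f(|x|θ) dσ(θ), with P^⊥ = Id − P. Then for all f ∈ C_0^∞(ℝ^n), (n^2/4) ∫ |x|^{-2} |P^⊥ f(x)|^2 dx ≤ ∫ |∇f(x)|^2 dx. -/
open MeasureTheory

/-- The area `ω_n = |S^{n-1}|` of the unit sphere in `ℝⁿ`, realized as the total
mass of the natural surface measure `volume.toSphere`. -/
noncomputable def sphereArea (n : ℕ) : ℝ :=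
  ((volume : Measure (EuclideanSpace ℝ (Fin n))).toSphere Set.univ).toReal

/-- The spherical averaging projection
`P f (x) = (1/ω_n) ∫_{S^{n-1}} f(|x| θ) dσ(θ)`. -/
noncomputable def sphericalAvg (n : ℕ) (f : EuclideanSpace ℝ (Fin n) → ℂ)
    (x : EuclideanSpace ℝ (Fin n)) : ℂ :=
  (sphereArea n)⁻¹ •
    ∫ θ : Metric.sphere (0 : EuclideanSpace ℝ (Fin n)) 1,
      f (‖x‖ • (θ : EuclideanSpace ℝ (Fin n)))
      ∂((volume : Measure (EuclideanSpace ℝ (Fin n))).toSphere)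


section GaussPart
open Real
variable {E : Type*} [NormedAddCommGroup E] [InnerProductSpace ℝ E] [FiniteDimensional ℝ E]
  [MeasurableSpace E] [BorelSpace E]

noncomputable def gs (E : Type*) [NormedAddCommGroup E] [InnerProductSpace ℝ E]
    [FiniteDimensional ℝ E] [MeasurableSpace E] [BorelSpace E] : Measure E :=
  volume.withDensity (fun x => ENNReal.ofReal (exp (-‖x‖ ^ 2 / 2)))

lemma integral_gs (k : E → ℝ) : ∫ x, k x ∂(gs E) = ∫ x, exp (-‖x‖ ^ 2 / 2) * k x := by
  rw [gs, integral_withDensity_eq_integral_toReal_smul (by fun_prop) (by simp)]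
  simp [ENNReal.toReal_ofReal (exp_pos _).le]

lemma integrable_gs_iff (k : E → ℝ) :
    Integrable k (gs E) ↔ Integrable (fun x => exp (-‖x‖ ^ 2 / 2) * k x) := by
  rw [gs, integrable_withDensity_iff_integrable_smul' (by fun_prop) (by simp)]
  simp [ENNReal.toReal_ofReal (exp_pos _).le]

lemma integrable_exp_gs (c : ℝ) : Integrable (fun x : E => exp (c * ‖x‖)) (gs E) := by
  rw [integrable_gs_iff]
  have h := (GaussianFourier.integrable_cexp_neg_mul_sq_norm_add (V := E) (b := 1 / 4)
    (by norm_num) 0 0).norm.const_mul (exp (c ^ 2))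
  refine h.mono' (by fun_prop) (.of_forall fun x => ?_)
  rw [Complex.norm_exp, ← exp_add, ← exp_add, norm_of_nonneg (exp_pos _).le]
  apply exp_le_exp.2
  have : (-(1 / 4 : ℂ) * (‖x‖ : ℂ) ^ 2 + 0 * (inner ℝ (0 : E) x : ℝ)).re = -(1 / 4) * ‖x‖ ^ 2 := by
    rw [zero_mul, add_zero, show (-(1 / 4 : ℂ) * (‖x‖ : ℂ) ^ 2) = ((-(1 / 4) * ‖x‖ ^ 2 : ℝ) : ℂ) by
      push_cast; ring, Complex.ofReal_re]
  rw [this]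
  nlinarith [sq_nonneg (c - ‖x‖ / 2)]

instance : IsFiniteMeasure (gs E) := by
  have := integrable_exp_gs (E := E) 0
  simp only [zero_mul, exp_zero] at this
  rwa [integrable_const_iff_isFiniteMeasure one_ne_zero] at this

lemma rotation_vol (s c : ℝ) (h : c ^ 2 + s ^ 2 = 1) :
    MeasurePreserving (fun p : E × E => (c • p.1 + s • p.2, -s • p.1 + c • p.2))
      (volume.prod volume) (volume.prod volume) := by
  let R : ℝ → (E × E →ₗ[ℝ] E × E) := fun s =>
    LinearMap.prod (c • LinearMap.fst ℝ E E + s • LinearMap.snd ℝ E E)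
      (-s • LinearMap.fst ℝ E E + c • LinearMap.snd ℝ E E)
  let S : E × E →ₗ[ℝ] E × E := LinearMap.prod (LinearMap.fst ℝ E E) (- LinearMap.snd ℝ E E)
  have h1 : R (-s) ∘ₗ R s = LinearMap.id := by
    apply LinearMap.ext
    rintro ⟨x, y⟩
    have e : c * c + s * s = 1 := by linarith
    change (c • (c • x + s • y) + -s • (-s • x + c • y),
      - -s • (c • x + s • y) + c • (-s • x + c • y)) = (x, y)
    refine Prod.ext ?_ ?_
    · calc _ = (c * c + s * s) • x := by module
        _ = x := by rw [e, one_smul]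
    · calc _ = (c * c + s * s) • y := by module
        _ = y := by rw [e, one_smul]
  have h2 : S ∘ₗ R s ∘ₗ S = R (-s) := by
    apply LinearMap.ext
    rintro ⟨x, y⟩
    change (c • x + s • (-y), -(-s • x + c • (-y))) = (c • x + -s • y, - -s • x + c • y)
    refine Prod.ext ?_ ?_
    · change c • x + s • (-y) = c • x + -s • y
      module
    · change -(-s • x + c • (-y)) = - -s • x + c • y
      module
  have h3 : S ∘ₗ S = LinearMap.id := by
    apply LinearMap.ext
    rintro ⟨x, y⟩
    simp [S]
  have d1 := congrArg LinearMap.det h1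
  have d2 := congrArg LinearMap.det h2
  have d3 := congrArg LinearMap.det h3
  rw [LinearMap.det_comp, LinearMap.det_id] at d1 d3
  rw [LinearMap.det_comp, LinearMap.det_comp] at d2
  have d4 : LinearMap.det (R s) * LinearMap.det (R s) = 1 := by
    rw [← d1, ← d2]
    linear_combination (-(LinearMap.det (R s))^2) * d3
  have d5 : |LinearMap.det (R s)| = 1 := by
    rcases mul_self_eq_one_iff.1 d4 with h | h <;> simp [h]
  have hne : LinearMap.det (R s) ≠ 0 := by
    intro h0; simp [h0] at d5
  have := Measure.map_linearMap_addHaar_eq_smul_addHaar ((volume : Measure E).prod volume) hne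
  rw [abs_inv, d5, inv_one, ENNReal.ofReal_one, one_smul] at this
  exact ⟨by fun_prop, this⟩

lemma gs_prod : (gs E).prod (gs E) = ((volume : Measure E).prod volume).withDensity
    (fun p => ENNReal.ofReal (exp (-(‖p.1‖ ^ 2 + ‖p.2‖ ^ 2) / 2))) := by
  rw [gs, prod_withDensity (by fun_prop) (by fun_prop)]
  congr 1
  ext p
  rw [← ENNReal.ofReal_mul (exp_pos _).le, ← exp_add]
  congr 2
  ring

lemma rotation_gs (s c : ℝ) (h : c ^ 2 + s ^ 2 = 1) :
    MeasurePreserving (fun p : E × E => (c • p.1 + s • p.2, -s • p.1 + c • p.2))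
      ((gs E).prod (gs E)) ((gs E).prod (gs E)) := by
  have hv := rotation_vol (E := E) s c h
  refine ⟨hv.measurable, ?_⟩
  ext A hA
  rw [Measure.map_apply hv.measurable hA, gs_prod, withDensity_apply _ hA,
    withDensity_apply _ (hv.measurable hA), ← hv.setLIntegral_comp_preimage hA (by fun_prop)]
  congr 1
  ext p
  congr 3
  simp only [norm_add_sq_real, norm_smul, inner_smul_left, inner_smul_right, mul_pow, norm_eq_abs,
    sq_abs, conj_trivial]
  linear_combination (‖p.1‖^2 + ‖p.2‖^2) * h

lemma gs_ibp (k : E → ℝ) (hk : Differentiable ℝ k) (v : E) (C b : ℝ)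
    (h0 : ∀ x, |k x| ≤ C * exp (b * ‖x‖)) (h1 : ∀ x, ‖fderiv ℝ k x‖ ≤ C * exp (b * ‖x‖)) :
    ∫ x, k x * inner ℝ v x ∂(gs E) = ∫ x, fderiv ℝ k x v ∂(gs E) := by
  have hI : ∀ c, Integrable (fun x : E => exp (-‖x‖ ^ 2 / 2) * exp (c * ‖x‖)) := fun c =>
    (integrable_gs_iff _).1 (integrable_exp_gs c)
  have hkc : Measurable k := hk.continuous.measurable
  have hC : 0 ≤ C := by
    by_contra hC
    have := (abs_nonneg _).trans (h0 0)
    simp at this; linarith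
  have hd : ∀ x : E, HasFDerivAt (fun x : E => exp (-‖x‖ ^ 2 / 2))
      (-(exp (-‖x‖ ^ 2 / 2)) • innerSL ℝ x) x := by
    intro x
    have := ((hasStrictFDerivAt_norm_sq x).hasFDerivAt.const_mul (-1 / 2 : ℝ)).exp
    have e : (fun x : E => exp (-‖x‖ ^ 2 / 2)) = fun x : E => exp ((-1 / 2 : ℝ) * ‖x‖ ^ 2) := by
      ext x; congr 1; ring
    rw [e]
    convert this using 1
    ext y
    simp
    ring_nf
  have key := integral_mul_fderiv_eq_neg_fderiv_mul_of_integrable (μ := (volume : Measure E))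
    (f := k) (g := fun x : E => exp (-‖x‖ ^ 2 / 2)) (v := v) ?_ ?_ ?_ (fun x _ => hk x)
    (fun x _ => (hd x).differentiableAt)
  · rw [integral_gs, integral_gs]
    have e : ∀ x : E, exp (-‖x‖ ^ 2 / 2) * (k x * inner ℝ v x) =
        - (k x * (fderiv ℝ (fun x : E => exp (-‖x‖ ^ 2 / 2)) x v)) := by
      intro x
      rw [(hd x).fderiv]
      simp [real_inner_comm]
      ring
    simp_rw [e]
    rw [integral_neg, key, neg_neg]
    simp_rw [mul_comm]
  · refine ((hI b).const_mul (C * ‖v‖)).mono' ?_ (.of_forall fun x => ?_)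
    · exact ((measurable_fderiv_apply_const ℝ k v).mul (by fun_prop)).aestronglyMeasurable
    · rw [norm_mul, norm_of_nonneg (exp_pos _).le]
      have := ((fderiv ℝ k x).le_opNorm v).trans (mul_le_mul_of_nonneg_right (h1 x) (norm_nonneg v))
      nlinarith [mul_le_mul_of_nonneg_right this (exp_pos (-‖x‖ ^ 2 / 2)).le]
  · refine ((hI (b + 1)).const_mul (C * ‖v‖)).mono' ?_ (.of_forall fun x => ?_)
    · exact (hkc.mul (measurable_fderiv_apply_const ℝ _ v)).aestronglyMeasurable
    · rw [(hd x).fderiv, norm_mul]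
      have a1 : ‖(-(exp (-‖x‖ ^ 2 / 2)) • innerSL ℝ x) v‖ ≤
          exp (-‖x‖ ^ 2 / 2) * (‖v‖ * exp (1 * ‖x‖)) := by
        simp only [neg_smul, neg_apply, norm_neg,
          smul_apply, norm_smul, norm_of_nonneg (exp_pos _).le]
        gcongr
        have : ‖inner ℝ x v‖ ≤ ‖x‖ * ‖v‖ := norm_inner_le_norm _ _
        simp only [innerSL_apply_apply]
        have : ‖x‖ ≤ exp (1 * ‖x‖) := by
          have := add_one_le_exp (1 * ‖x‖); linarith
        nlinarith [norm_nonneg v]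
      calc _ ≤ (C * exp (b * ‖x‖)) * (exp (-‖x‖ ^ 2 / 2) * (‖v‖ * exp (1 * ‖x‖))) :=
            mul_le_mul (h0 x) a1 (norm_nonneg _) (by positivity)
        _ = _ := by rw [add_mul, exp_add]; ring
  · refine ((hI b).const_mul C).mono' (by fun_prop) (.of_forall fun x => ?_)
    rw [norm_mul, norm_of_nonneg (exp_pos _).le]
    have := h0 x
    simp only [norm_eq_abs]
    nlinarith [mul_le_mul_of_nonneg_right this (exp_pos (-‖x‖ ^ 2 / 2)).le]


lemma gs_rot_fst (q : E → ℝ) (hq : Measurable q) (s c : ℝ) (h : c ^ 2 + s ^ 2 = 1) :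
    ∫ p, q (c • p.1 + s • p.2) ∂((gs E).prod (gs E)) =
      (gs E).real Set.univ * ∫ x, q x ∂(gs E) := by
  have hr := rotation_gs (E := E) s c h
  have h1 : ∫ p, q (p.1) ∂((gs E).prod (gs E)) =
      (gs E).real Set.univ * ∫ x, q x ∂(gs E) := by
    rw [integral_fun_fst (μ := gs E) (ν := gs E) q, smul_eq_mul]
  rw [← h1]
  conv_rhs => rw [← hr.map_eq]
  exact (integral_map (f := fun p : E × E => q p.1) hr.measurable.aemeasurable
    (hq.comp measurable_fst).aestronglyMeasurable).symm

lemma gs_exp_prod (a b : ℝ) : Integrable (fun p : E × E => exp (a * ‖p.1‖) * exp (b * ‖p.2‖))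
    ((gs E).prod (gs E)) :=
  (integrable_exp_gs a).mul_prod (integrable_exp_gs b)

lemma norm_rot_le (s c : ℝ) (h : c ^ 2 + s ^ 2 = 1) (x y : E) :
    ‖c • x + s • y‖ ≤ ‖x‖ + ‖y‖ := by
  have hc : |c| ≤ 1 := abs_le_one_iff_mul_self_le_one.2 (by nlinarith)
  have hs : |s| ≤ 1 := abs_le_one_iff_mul_self_le_one.2 (by nlinarith)
  refine (norm_add_le _ _).trans ?_
  rw [norm_smul, norm_smul, norm_eq_abs, norm_eq_abs]
  nlinarith [norm_nonneg x, norm_nonneg y]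

lemma measurable_gradient' (g : E → ℝ) : Measurable (gradient g) :=
  (InnerProductSpace.toDual ℝ E).symm.continuous.measurable.comp (measurable_fderiv ℝ g)

lemma fderiv_eq_inner_gradient (g : E → ℝ) (x v : E) :
    fderiv ℝ g x v = inner ℝ (gradient g x) v := by
  simp [gradient]

lemma norm_gradient_eq (g : E → ℝ) (x : E) : ‖gradient g x‖ = ‖fderiv ℝ g x‖ := by
  simp [gradient]


lemma gs_C_nonneg (g : E → ℝ) (C : ℝ) (h0 : ∀ x, |g x| ≤ C * exp ‖x‖) : 0 ≤ C := by
    by_contra hC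
    have := (abs_nonneg _).trans (h0 0)
    simp at this; linarith

lemma gs_deriv_bound (g : E → ℝ) (hg : Differentiable ℝ g) (C : ℝ)
    (h0 : ∀ x, |g x| ≤ C * exp ‖x‖) (h1 : ∀ x, ‖gradient g x‖ ≤ C * exp ‖x‖)
    (s c s' c' : ℝ) (h : c ^ 2 + s ^ 2 = 1) (h' : c' ^ 2 + s' ^ 2 = 1) (x y u : E)
    (hu : ‖u‖ ≤ ‖x‖ + ‖y‖) :
    |g u * inner ℝ (gradient g (c • x + s • y)) (c' • x + s' • y)| ≤
      C ^ 2 * (exp (3 * ‖x‖) * exp (3 * ‖y‖)) := by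
  have hC := gs_C_nonneg g C h0
  have e1 : ‖c' • x + s' • y‖ ≤ exp (‖x‖ + ‖y‖) :=
    (norm_rot_le s' c' h' x y).trans (by linarith [add_one_le_exp (‖x‖ + ‖y‖)])
  have e2 : ‖gradient g (c • x + s • y)‖ ≤ C * exp (‖x‖ + ‖y‖) :=
    (h1 _).trans (by gcongr; exact norm_rot_le s c h x y)
  have e3 : |g u| ≤ C * exp (‖x‖ + ‖y‖) := (h0 _).trans (by gcongr)
  rw [abs_mul]
  calc _ ≤ (C * exp (‖x‖ + ‖y‖)) * ((C * exp (‖x‖ + ‖y‖)) * exp (‖x‖ + ‖y‖)) := by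
        gcongr
        exact (abs_real_inner_le_norm _ _).trans (by gcongr)
    _ = C ^ 2 * (exp (‖x‖ + ‖y‖)) ^ 3 := by ring
    _ = _ := by rw [← exp_nat_mul, ← exp_add]; congr 2; push_cast; ring

lemma gs_deriv (g : E → ℝ) (hg : Differentiable ℝ g) (C : ℝ)
    (h0 : ∀ x, |g x| ≤ C * exp ‖x‖) (h1 : ∀ x, ‖gradient g x‖ ≤ C * exp ‖x‖)
    (t : ℝ) : HasDerivAt
    (fun t => ∫ p, g p.1 * g (cos t • p.1 + sin t • p.2) ∂((gs E).prod (gs E)))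
    (∫ p, g p.1 * inner ℝ (gradient g (cos t • p.1 + sin t • p.2)) (-sin t • p.1 + cos t • p.2)
      ∂((gs E).prod (gs E))) t := by
  have hC := gs_C_nonneg g C h0
  have hgc : Continuous g := hg.continuous
  have hGm := measurable_gradient' g
  refine (hasDerivAt_integral_of_dominated_loc_of_deriv_le (s := Set.univ)
    (bound := fun p : E × E => C ^ 2 * (exp (3 * ‖p.1‖) * exp (3 * ‖p.2‖)))
    (F := fun t (p : E × E) => g p.1 * g (cos t • p.1 + sin t • p.2))
    (F' := fun t (p : E × E) => g p.1 * inner ℝ (gradient g (cos t • p.1 + sin t • p.2)) (-sin t • p.1 + cos t • p.2))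
    Filter.univ_mem (.of_forall fun t => by fun_prop) ?_ ?_ ?_ ?_ ?_).2
  · refine ((gs_exp_prod 2 1).const_mul (C ^ 2)).mono' (by fun_prop) (.of_forall fun p => ?_)
    rw [norm_mul]
    calc _ ≤ (C * exp ‖p.1‖) * (C * exp (‖p.1‖ + ‖p.2‖)) := by
          refine mul_le_mul (h0 _) ((h0 _).trans ?_) (norm_nonneg _) (by positivity)
          gcongr
          exact norm_rot_le _ _ (cos_sq_add_sin_sq t) _ _
      _ = C ^ 2 * (exp ‖p.1‖ * exp (‖p.1‖ + ‖p.2‖)) := by ring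
      _ = _ := by rw [← exp_add, ← exp_add]; congr 2; ring
  · apply Measurable.aestronglyMeasurable
    have : Measurable (fun p : E × E => gradient g (cos t • p.1 + sin t • p.2)) :=
      hGm.comp (by fun_prop)
    fun_prop
  · refine .of_forall fun p t _ => ?_
    exact gs_deriv_bound g hg C h0 h1 (sin t) (cos t) (cos t) (-sin t) (by simp)
      (by simp [sin_sq_add_cos_sq]) p.1 p.2 p.1 (by simp)
  · exact (gs_exp_prod 3 3).const_mul (C ^ 2)
  · refine .of_forall fun p t _ => ?_
    have a : HasDerivAt (fun t => cos t • p.1 + sin t • p.2) (-sin t • p.1 + cos t • p.2) t :=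
      ((hasDerivAt_cos t).smul_const _).add ((hasDerivAt_sin t).smul_const _)
    have b := ((hg _).hasFDerivAt.comp_hasDerivAt t a).const_mul (g p.1)
    rw [fderiv_eq_inner_gradient] at b
    exact b

lemma gs_deriv_lower (g : E → ℝ) (hg : Differentiable ℝ g) (C : ℝ)
    (h0 : ∀ x, |g x| ≤ C * exp ‖x‖) (h1 : ∀ x, ‖gradient g x‖ ≤ C * exp ‖x‖)
    (s c : ℝ) (h : c ^ 2 + s ^ 2 = 1) (hs : 0 ≤ s) :
    -s * ((gs E).real Set.univ * ∫ x, ‖gradient g x‖ ^ 2 ∂(gs E)) ≤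
    ∫ p, g p.1 * inner ℝ (gradient g (c • p.1 + s • p.2)) (-s • p.1 + c • p.2)
      ∂((gs E).prod (gs E)) := by
  have hC := gs_C_nonneg g C h0
  have hgc : Continuous g := hg.continuous
  have hGm := measurable_gradient' g
  have hr := rotation_gs (E := E) s c h
  have h' : c ^ 2 + (-s) ^ 2 = 1 := by simpa using h
  let F : E × E → ℝ := fun p => g (c • p.1 + (-s) • p.2) * inner ℝ (gradient g p.1) p.2
  have hFm : Measurable F := by
    have : Measurable (fun p : E × E => gradient g p.1) := hGm.comp (by fun_prop)
    fun_prop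
  have hFi : Integrable F ((gs E).prod (gs E)) := by
    refine ((gs_exp_prod 3 3).const_mul (C ^ 2)).mono' hFm.aestronglyMeasurable
      (.of_forall fun p => ?_)
    have := gs_deriv_bound g hg C h0 h1 0 1 1 0 (by simp) (by simp) p.1 p.2
      (c • p.1 + (-s) • p.2) (norm_rot_le _ _ h' _ _)
    simpa [F] using this
  have e1 : ∫ p, g p.1 * inner ℝ (gradient g (c • p.1 + s • p.2)) (-s • p.1 + c • p.2)
      ∂((gs E).prod (gs E)) = ∫ p, F p ∂((gs E).prod (gs E)) := by
    conv_rhs => rw [← hr.map_eq]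
    rw [integral_map hr.measurable.aemeasurable hFm.aestronglyMeasurable]
    congr 1
    ext p
    simp only [F]
    congr 2
    calc p.1 = (c ^ 2 + s ^ 2) • p.1 := by rw [h, one_smul]
      _ = _ := by module
  let K : E × E → ℝ := fun p => inner ℝ (gradient g (c • p.1 + (-s) • p.2)) (gradient g p.1)
  have m1 : Measurable (fun p : E × E => gradient g p.1) := hGm.comp (by fun_prop)
  have m2 : Measurable (fun p : E × E => gradient g (c • p.1 + (-s) • p.2)) := hGm.comp (by fun_prop)
  have hb2 : ∀ p : E × E, ‖gradient g (c • p.1 + (-s) • p.2)‖ ≤ C * exp (‖p.1‖ + ‖p.2‖) := fun p =>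
    (h1 _).trans (by gcongr; exact norm_rot_le _ _ h' _ _)
  have hKm : Measurable K := by fun_prop
  have i2 : Integrable (fun p : E × E => ‖gradient g (c • p.1 + (-s) • p.2)‖ ^ 2)
      ((gs E).prod (gs E)) := by
    refine ((gs_exp_prod 2 2).const_mul (C ^ 2)).mono' (Measurable.aestronglyMeasurable (by fun_prop))
      (.of_forall fun p => ?_)
    rw [norm_of_nonneg (by positivity)]
    calc _ ≤ (C * exp (‖p.1‖ + ‖p.2‖)) ^ 2 := by gcongr; exact hb2 p
      _ = C ^ 2 * (exp (‖p.1‖ + ‖p.2‖)) ^ 2 := by ring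
      _ = _ := by rw [← exp_nat_mul, ← exp_add]; congr 2; push_cast; ring
  have i1 : Integrable (fun p : E × E => ‖gradient g p.1‖ ^ 2) ((gs E).prod (gs E)) := by
    refine ((gs_exp_prod 2 0).const_mul (C ^ 2)).mono' (Measurable.aestronglyMeasurable (by fun_prop))
      (.of_forall fun p => ?_)
    rw [norm_of_nonneg (by positivity)]
    calc _ ≤ (C * exp (‖p.1‖)) ^ 2 := by gcongr; exact h1 _
      _ = C ^ 2 * (exp (‖p.1‖)) ^ 2 := by ring
      _ = _ := by rw [← exp_nat_mul, ← exp_add]; congr 2; push_cast; ring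
  have hKle : ∀ p, K p ≤ (‖gradient g (c • p.1 + (-s) • p.2)‖ ^ 2 + ‖gradient g p.1‖ ^ 2) / 2 := by
    intro p
    have := real_inner_le_norm (gradient g (c • p.1 + (-s) • p.2)) (gradient g p.1)
    simp only [K]
    nlinarith [sq_nonneg (‖gradient g (c • p.1 + (-s) • p.2)‖ - ‖gradient g p.1‖)]
  have hKi : Integrable K ((gs E).prod (gs E)) := by
    refine ((i2.add i1).div_const 2).mono' hKm.aestronglyMeasurable (.of_forall fun p => ?_)
    have := abs_real_inner_le_norm (gradient g (c • p.1 + (-s) • p.2)) (gradient g p.1)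
    simp only [K, norm_eq_abs, Pi.add_apply]
    nlinarith [sq_nonneg (‖gradient g (c • p.1 + (-s) • p.2)‖ - ‖gradient g p.1‖)]
  have e2 : ∫ p, F p ∂((gs E).prod (gs E)) = -s * ∫ p, K p ∂((gs E).prod (gs E)) := by
    rw [integral_prod _ hFi, integral_prod _ hKi, ← integral_const_mul]
    congr 1
    ext z
    have hs1 : |s| ≤ 1 := abs_le_one_iff_mul_self_le_one.2 (by nlinarith)
    have hfd : ∀ w, HasFDerivAt (fun w => g (c • z + (-s) • w))
        ((-s) • fderiv ℝ g (c • z + (-s) • w)) w := by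
      intro w
      have a : HasFDerivAt (fun w => c • z + (-s) • w) ((-s) • ContinuousLinearMap.id ℝ E) w :=
        ((hasFDerivAt_id w).const_smul (-s)).const_add _
      have := (hg (c • z + (-s) • w)).hasFDerivAt.comp w a
      have e : fderiv ℝ g (c • z + (-s) • w) ∘SL ((-s) • ContinuousLinearMap.id ℝ E) =
          (-s) • fderiv ℝ g (c • z + (-s) • w) := by
        ext v
        simp
      rw [← e]
      exact this
    have := gs_ibp (fun w => g (c • z + (-s) • w)) (fun w => (hfd w).differentiableAt)
      (gradient g z) (C * exp ‖z‖) 1 ?_ ?_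
    · simp only [F]
      rw [this, ← integral_const_mul]
      congr 1
      ext w
      rw [(hfd w).fderiv, smul_apply, fderiv_eq_inner_gradient, smul_eq_mul]
    · intro w
      rw [mul_assoc, ← exp_add, one_mul]
      exact (h0 _).trans (by gcongr; exact norm_rot_le _ _ h' _ _)
    · intro w
      rw [mul_assoc, ← exp_add, one_mul, (hfd w).fderiv, norm_smul, norm_neg, norm_eq_abs,
        ← norm_gradient_eq]
      exact (mul_le_of_le_one_left (norm_nonneg _) hs1).trans (hb2 (z, w))
  rw [e1, e2]
  have e3 : ∫ p, K p ∂((gs E).prod (gs E)) ≤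
      (gs E).real Set.univ * ∫ x, ‖gradient g x‖ ^ 2 ∂(gs E) := by
    refine (integral_mono hKi ((i2.add i1).div_const 2) hKle).trans (le_of_eq ?_)
    rw [integral_div, integral_add' i2 i1,
      gs_rot_fst (fun x => ‖gradient g x‖ ^ 2) (by fun_prop) (-s) c h']
    have := gs_rot_fst (fun x => ‖gradient g x‖ ^ 2) (by fun_prop) 0 1 (by simp)
    simp only [one_smul, zero_smul, add_zero] at this
    rw [this]
    ring
  nlinarith

theorem gs_poincare (g : E → ℝ) (hg : Differentiable ℝ g) (C : ℝ)
    (h0 : ∀ x, |g x| ≤ C * exp ‖x‖) (h1 : ∀ x, ‖gradient g x‖ ≤ C * exp ‖x‖)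
    (hm : ∫ x, g x ∂(gs E) = 0) :
    ∫ x, g x ^ 2 ∂(gs E) ≤ ∫ x, ‖gradient g x‖ ^ 2 ∂(gs E) := by
  have hgc : Continuous g := hg.continuous
  set D := ∫ x, ‖gradient g x‖ ^ 2 ∂(gs E)
  set m := (gs E).real Set.univ with hmdef
  have hmpos : 0 < m := by
    rw [hmdef, measureReal_def, ENNReal.toReal_pos_iff]
    refine ⟨?_, measure_lt_top _ _⟩
    rw [pos_iff_ne_zero, Ne, Measure.measure_univ_eq_zero, gs, withDensity_eq_zero_iff (by fun_prop)]
    intro hz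
    have h3 : ∀ᵐ x : E, False := by
      filter_upwards [hz] with x hx
      simp only [Pi.zero_apply, ENNReal.ofReal_eq_zero] at hx
      exact absurd (exp_pos (-‖x‖ ^ 2 / 2)) (not_lt.2 hx)
    exact h3.exists.elim fun _ h => h
  let Φ : ℝ → ℝ := fun t => ∫ p, g p.1 * g (cos t • p.1 + sin t • p.2) ∂((gs E).prod (gs E))
  have hd : ∀ t, HasDerivAt (fun t => Φ t - m * D * cos t)
    ((∫ p, g p.1 * inner ℝ (gradient g (cos t • p.1 + sin t • p.2)) (-sin t • p.1 + cos t • p.2)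
      ∂((gs E).prod (gs E))) - m * D * (-sin t)) t := fun t =>
    (gs_deriv g hg C h0 h1 t).sub ((hasDerivAt_cos t).const_mul _)
  have mono : MonotoneOn (fun t => Φ t - m * D * cos t) (Set.Icc 0 (π / 2)) := by
    refine monotoneOn_of_deriv_nonneg (convex_Icc _ _)
      (fun t _ => (hd t).continuousAt.continuousWithinAt)
      (fun t _ => (hd t).differentiableAt.differentiableWithinAt) fun t ht => ?_
    rw [interior_Icc] at ht
    rw [(hd t).deriv]
    have := gs_deriv_lower g hg C h0 h1 (sin t) (cos t) (by simp)
      (sin_nonneg_of_nonneg_of_le_pi ht.1.le (by linarith [ht.2, pi_pos]))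
    simp only [D, m]
    linarith
  have := mono (Set.left_mem_Icc.2 (by positivity)) (Set.right_mem_Icc.2 (by positivity))
    (by positivity)
  simp only [Φ, cos_zero, sin_zero, cos_pi_div_two, sin_pi_div_two, one_smul, zero_smul, add_zero,
    zero_add, mul_zero, mul_one] at this
  rw [integral_prod_mul (μ := gs E) (ν := gs E) g g, hm] at this
  have e : ∫ p, g p.1 * g p.1 ∂((gs E).prod (gs E)) = m * ∫ x, g x ^ 2 ∂(gs E) := by
    rw [integral_fun_fst (μ := gs E) (ν := gs E) (fun x => g x * g x), smul_eq_mul]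
    simp_rw [sq]
    rfl
  rw [e] at this
  have : m * ∫ x, g x ^ 2 ∂(gs E) ≤ m * D := by linarith
  exact le_of_mul_le_mul_left this hmpos

end GaussPart

section SpherePart
open Real Set
variable {E : Type*} [NormedAddCommGroup E] [InnerProductSpace ℝ E] [FiniteDimensional ℝ E]
  [MeasurableSpace E] [BorelSpace E]

lemma polar_general [Nontrivial E] (F : E → ℝ) :
    ∫ x, F x = ∫ z : Metric.sphere (0 : E) 1 × Ioi (0 : ℝ), F ((z.2 : ℝ) • (z.1 : E))
      ∂((volume : Measure E).toSphere.prod (.volumeIoiPow (Module.finrank ℝ E - 1))) := by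
  calc ∫ x, F x = ∫ x : ({(0)}ᶜ : Set E), F x ∂((volume : Measure E).comap (↑)) := by
        rw [integral_subtype_comap (measurableSet_singleton _).compl F, restrict_compl_singleton]
    _ = _ := by
      rw [← (volume : Measure E).measurePreserving_homeomorphUnitSphereProd.integral_comp
        (Homeomorph.measurableEmbedding _)]
      congr 1
      ext x
      congr 1
      have hx : ‖(x : E)‖ ≠ 0 := norm_ne_zero_iff.2 x.2
      simp [smul_smul, hx]

lemma integral_volumeIoiPow (k : ℕ) (φ : ℝ → ℝ) :
    ∫ r : Ioi (0 : ℝ), φ r ∂(Measure.volumeIoiPow k) = ∫ r in Ioi (0 : ℝ), r ^ k * φ r := by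
  simp only [Measure.volumeIoiPow, ENNReal.ofReal]
  rw [integral_withDensity_eq_integral_smul (measurable_subtype_coe.pow_const _).real_toNNReal,
    integral_subtype_comap measurableSet_Ioi fun a ↦ Real.toNNReal (a ^ k) • φ a,
    setIntegral_congr_fun measurableSet_Ioi fun x hx ↦ ?_]
  rw [NNReal.smul_def, Real.coe_toNNReal _ (pow_nonneg hx.out.le _), smul_eq_mul]

lemma polar_prod [Nontrivial E] (φ : ℝ → ℝ) (k : E → ℝ) :
    ∫ x : E, φ ‖x‖ * k (‖x‖⁻¹ • x) =
      (∫ r in Ioi (0 : ℝ), r ^ (Module.finrank ℝ E - 1) * φ r) *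
      ∫ θ : Metric.sphere (0 : E) 1, k θ ∂((volume : Measure E).toSphere) := by
  rw [polar_general, ← integral_volumeIoiPow, mul_comm,
    ← integral_prod_mul (fun θ : Metric.sphere (0 : E) 1 => k θ)
      (fun r : Ioi (0 : ℝ) => φ r)]
  congr 1
  ext z
  have hr : (0 : ℝ) < z.2 := z.2.2
  have hz : ‖(z.1 : E)‖ = 1 := by simp
  rw [norm_smul, hz, mul_one, norm_of_nonneg hr.le, smul_smul, inv_mul_cancel₀ hr.ne', one_smul,
    mul_comm]

noncomputable def gI (q : ℝ) : ℝ := ∫ r in Ioi (0 : ℝ), r ^ q * exp (-r ^ 2 / 2)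

lemma gI_eq (q : ℝ) (hq : -1 < q) :
    gI q = (1 / 2 : ℝ) ^ (-(q + 1) / 2) * (1 / 2) * Gamma ((q + 1) / 2) := by
  rw [← integral_rpow_mul_exp_neg_mul_rpow two_pos hq (by norm_num : (0 : ℝ) < 1 / 2), gI]
  congr 1
  ext r
  rw [rpow_two]
  congr 2
  ring

lemma gI_pos (q : ℝ) (hq : -1 < q) : 0 < gI q := by
  rw [gI_eq q hq]
  have := Gamma_pos_of_pos (show 0 < (q + 1) / 2 by linarith)
  positivity

lemma gI_add_two (q : ℝ) (hq : -1 < q) : gI (q + 2) = (q + 1) * gI q := by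
  rw [gI_eq q hq, gI_eq (q + 2) (by linarith),
    show (q + 2 + 1) / 2 = (q + 1) / 2 + 1 by ring, Gamma_add_one (by linarith),
    show -(q + 2 + 1) / 2 = -(q + 1) / 2 + (-1) by ring,
    rpow_add (by norm_num), rpow_neg_one]
  ring

lemma gI_nat (k : ℕ) (q : ℝ) :
    ∫ r in Ioi (0 : ℝ), r ^ k * (exp (-r ^ 2 / 2) * r ^ q) = gI (k + q) := by
  rw [gI]
  refine setIntegral_congr_fun measurableSet_Ioi fun r hr => ?_
  rw [rpow_add hr, rpow_natCast]
  ring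

/-- the homogeneous extension of degree `a` -/
noncomputable def hext (h : E → ℝ) (a : ℝ) (x : E) : ℝ := ‖x‖ ^ a * h (‖x‖⁻¹ • x)

lemma hext_fderiv (h : E → ℝ) (hh : Differentiable ℝ h) (a : ℝ) (ha : 1 < a) (x : E) (hx : x ≠ 0) :
    HasFDerivAt (hext h a) (innerSL ℝ (‖x‖ ^ (a - 1) • ((a * h (‖x‖⁻¹ • x) -
      inner ℝ (gradient h (‖x‖⁻¹ • x)) (‖x‖⁻¹ • x)) • (‖x‖⁻¹ • x) + gradient h (‖x‖⁻¹ • x)))) x := by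
  have hr : 0 < ‖x‖ := norm_pos_iff.2 hx
  have d1 := hasFDerivAt_norm_rpow x ha
  have d2 : HasFDerivAt (fun x : E => ‖x‖⁻¹) (-(‖x‖⁻¹ ^ 3) • innerSL ℝ x) x := by
    have := ((hasStrictFDerivAt_norm_sq x).hasFDerivAt.sqrt (by positivity))
    simp only [Real.sqrt_sq (norm_nonneg _)] at this
    have h2 := (hasDerivAt_inv hr.ne').comp_hasFDerivAt x this
    refine h2.congr_fderiv ?_
    ext v
    simp only [smul_apply, innerSL_apply_apply, smul_eq_mul, nsmul_eq_mul]
    push_cast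
    field_simp
  have d3 : HasFDerivAt (fun x : E => ‖x‖⁻¹ • x)
      (‖x‖⁻¹ • ContinuousLinearMap.id ℝ E + (-(‖x‖⁻¹ ^ 3) • innerSL ℝ x).smulRight x) x :=
    d2.smul (hasFDerivAt_id x)
  have d4 := d1.mul (HasFDerivAt.comp (g := h) (f := fun x : E => ‖x‖⁻¹ • x) x (hh (‖x‖⁻¹ • x)).hasFDerivAt d3)
  refine d4.congr_fderiv ?_
  ext v
  simp only [fderiv_eq_inner_gradient, innerSL_apply_apply, add_apply, smul_apply, inner_smul_left,
    inner_add_left, inner_add_right, inner_smul_right, conj_trivial, smul_eq_mul, Function.comp,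
    ContinuousLinearMap.comp_apply, ContinuousLinearMap.smulRight_apply, id,
    ContinuousLinearMap.id_apply]
  have e1 : ‖x‖ ^ a = ‖x‖ ^ (a - 2) * ‖x‖ ^ 2 := by
    rw [← rpow_natCast, ← rpow_add hr]; congr 1; norm_num
  have e2 : ‖x‖ ^ (a - 1) = ‖x‖ ^ (a - 2) * ‖x‖ := by
    nth_rw 3 [← rpow_one ‖x‖]
    rw [← rpow_add hr]; congr 1; ring
  rw [e1, e2]
  field_simp
  ring

lemma hext_fderiv_zero (h : E → ℝ) (a : ℝ) (ha : 1 < a) (M : ℝ)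
    (hM : ∀ θ : E, ‖θ‖ = 1 → |h θ| ≤ M) :
    HasFDerivAt (hext h a) (0 : E →L[ℝ] ℝ) 0 := by
  have d1 := hasFDerivAt_norm_rpow (0 : E) ha
  have ha0 : a ≠ 0 := by linarith
  simp only [map_zero, smul_zero] at d1
  rw [hasFDerivAt_iff_isLittleO_nhds_zero] at d1 ⊢
  simp only [zero_add, norm_zero, zero_rpow ha0, sub_zero, zero_apply] at d1
  simp only [hext, zero_add, norm_zero, zero_rpow ha0, sub_zero, zero_apply, zero_mul]
  refine Asymptotics.IsBigO.trans_isLittleO (Asymptotics.IsBigO.of_bound M (.of_forall fun x => ?_)) d1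
  by_cases hx : x = 0
  · simp [hx, zero_rpow ha0]
  · rw [norm_mul, mul_comm]
    gcongr
    exact hM _ (by simp [norm_smul, hx])

lemma sphere_poincare_aux [Nontrivial E] (h : E → ℝ) (hh : ContDiff ℝ 1 h)
    (hm : ∫ θ : Metric.sphere (0 : E) 1, h θ ∂((volume : Measure E).toSphere) = 0)
    (a : ℝ) (ha : 1 < a) (ha2 : a ≤ 2) :
    (Module.finrank ℝ E + 2 * a - 2 - a ^ 2) *
      ∫ θ : Metric.sphere (0 : E) 1, h θ ^ 2 ∂((volume : Measure E).toSphere) ≤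
    ∫ θ : Metric.sphere (0 : E) 1, (‖gradient h θ‖ ^ 2 - inner ℝ (gradient h θ) (θ : E) ^ 2)
      ∂((volume : Measure E).toSphere) := by
  have hd : Differentiable ℝ h := hh.differentiable (by simp)
  have hGc : Continuous (gradient h) :=
    (InnerProductSpace.toDual ℝ E).symm.continuous.comp (hh.continuous_fderiv (by simp))
  have hc := hh.continuous
  have hS := isCompact_sphere (0 : E) 1
  obtain ⟨M, hM⟩ := hS.exists_bound_of_continuousOn hc.continuousOn
  obtain ⟨M', hM'⟩ := hS.exists_bound_of_continuousOn hGc.continuousOn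
  simp only [mem_sphere_zero_iff_norm, norm_eq_abs] at hM hM'
  obtain ⟨θ₀, hθ₀⟩ := exists_norm_eq E zero_le_one
  have hMpos : 0 ≤ M := (abs_nonneg _).trans (hM θ₀ hθ₀)
  have hMpos' : 0 ≤ M' := (norm_nonneg _).trans (hM' θ₀ hθ₀)
  have ha0 : a ≠ 0 := by linarith
  have grad : ∀ x : E, x ≠ 0 → gradient (hext h a) x = (‖x‖ ^ (a - 1) • ((a * h (‖x‖⁻¹ • x) -
      inner ℝ (gradient h (‖x‖⁻¹ • x)) (‖x‖⁻¹ • x)) • (‖x‖⁻¹ • x) + gradient h (‖x‖⁻¹ • x))) := by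
    intro x hx
    apply ext_inner_right ℝ
    intro v
    rw [← fderiv_eq_inner_gradient, (hext_fderiv h hd a ha x hx).fderiv, innerSL_apply_apply]
  have grad0 : gradient (hext h a) 0 = 0 := by
    simp [gradient, (hext_fderiv_zero h a ha M hM).fderiv]
  have hdiff : Differentiable ℝ (hext h a) := by
    intro x
    by_cases hx : x = 0
    · rw [hx]; exact (hext_fderiv_zero h a ha M hM).differentiableAt
    · exact (hext_fderiv h hd a ha x hx).differentiableAt
  have hn : ∀ x : E, x ≠ 0 → ‖‖x‖⁻¹ • x‖ = 1 := fun x hx => by simp [norm_smul, hx]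
  have exp1 : ∀ t : ℝ, 0 ≤ t → t ^ (a - 1) ≤ exp t := by
    intro t ht
    rcases le_total t 1 with h1 | h1
    · exact (rpow_le_one ht h1 (by linarith)).trans (one_le_exp ht)
    · calc t ^ (a - 1) ≤ t ^ (1 : ℝ) := rpow_le_rpow_of_exponent_le h1 (by linarith)
        _ = t := rpow_one t
        _ ≤ exp t := by linarith [add_one_le_exp t]
  have exp2 : ∀ t : ℝ, 0 ≤ t → t ^ a ≤ 2 * exp t := by
    intro t ht
    have hq := quadratic_le_exp_of_nonneg ht
    rcases le_total t 1 with h1 | h1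
    · exact (rpow_le_one ht h1 (by linarith)).trans (by nlinarith)
    · calc t ^ a ≤ t ^ (2 : ℝ) := rpow_le_rpow_of_exponent_le h1 ha2
        _ = t ^ 2 := rpow_two t
        _ ≤ 2 * exp t := by nlinarith
  have key := gs_poincare (hext h a) hdiff (2 * M + 2 * M') ?_ ?_ ?_
  · rw [integral_gs, integral_gs] at key
    have e1 : ∫ x : E, exp (-‖x‖ ^ 2 / 2) * hext h a x ^ 2 =
        gI ((Module.finrank ℝ E - 1 : ℕ) + 2 * a) *
        ∫ θ : Metric.sphere (0 : E) 1, h θ ^ 2 ∂((volume : Measure E).toSphere) := by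
      rw [← gI_nat, ← polar_prod (fun r => exp (-r ^ 2 / 2) * r ^ (2 * a)) (fun x => h x ^ 2)]
      congr 1
      ext x
      rw [hext, mul_pow, mul_assoc, mul_comm 2 a, rpow_mul (norm_nonneg _), rpow_two]
    have e2 : ∫ x : E, exp (-‖x‖ ^ 2 / 2) * ‖gradient (hext h a) x‖ ^ 2 =
        gI ((Module.finrank ℝ E - 1 : ℕ) + 2 * (a - 1)) *
        ∫ θ : Metric.sphere (0 : E) 1, (a ^ 2 * h θ ^ 2 + (‖gradient h θ‖ ^ 2 - inner ℝ (gradient h θ) (θ : E) ^ 2)) ∂((volume : Measure E).toSphere) := by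
      rw [← gI_nat, ← polar_prod (fun r => exp (-r ^ 2 / 2) * r ^ (2 * (a - 1)))
        (fun θ => a ^ 2 * h θ ^ 2 + (‖gradient h θ‖ ^ 2 - inner ℝ (gradient h θ) θ ^ 2))]
      congr 1
      ext x
      by_cases hx : x = 0
      · have : (0 : ℝ) ^ (2 * (a - 1)) = 0 := zero_rpow (by linarith)
        simp [hx, grad0, this]
      · rw [grad x hx]
        have h1 := hn x hx
        set θ := ‖x‖⁻¹ • x
        rw [norm_smul, mul_pow, norm_add_sq_real, norm_smul, h1, inner_smul_left,
          norm_of_nonneg (by positivity), real_inner_comm θ, norm_eq_abs, mul_one, sq_abs,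
          mul_comm 2 (a - 1), rpow_mul (norm_nonneg _), rpow_two]
        simp only [conj_trivial]
        ring
    rw [e1, e2] at key
    have hfin : 1 ≤ Module.finrank ℝ E := Module.finrank_pos
    have hq : (-1 : ℝ) < (Module.finrank ℝ E - 1 : ℕ) + 2 * (a - 1) := by
      have : (0 : ℝ) ≤ (Module.finrank ℝ E - 1 : ℕ) := Nat.cast_nonneg _
      linarith
    rw [show ((Module.finrank ℝ E - 1 : ℕ) + 2 * a : ℝ) =
      (Module.finrank ℝ E - 1 : ℕ) + 2 * (a - 1) + 2 by ring, gI_add_two _ hq, mul_comm (_ + 1),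
      mul_assoc] at key
    have key2 := le_of_mul_le_mul_left key (gI_pos _ hq)
    rw [integral_add, integral_const_mul] at key2
    · push_cast [hfin] at key2
      linarith
    · exact Continuous.integrable_of_hasCompactSupport (by fun_prop)
        (HasCompactSupport.of_compactSpace _)
    · exact Continuous.integrable_of_hasCompactSupport (by fun_prop)
        (HasCompactSupport.of_compactSpace _)
  · intro x
    by_cases hx : x = 0
    · simp only [hx, hext, norm_zero, zero_rpow ha0, zero_mul, abs_zero]
      positivity
    · rw [hext, abs_mul, abs_of_nonneg (by positivity)]
      calc _ ≤ (2 * exp ‖x‖) * M := by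
            gcongr
            · exact exp2 _ (norm_nonneg _)
            · exact hM _ (hn x hx)
        _ ≤ _ := by nlinarith [mul_nonneg hMpos' (exp_pos ‖x‖).le]
  · intro x
    by_cases hx : x = 0
    · simp only [hx, grad0, norm_zero]
      positivity
    · rw [grad x hx, norm_smul, norm_of_nonneg (by positivity), mul_comm]
      have h1 := hn x hx
      set θ := ‖x‖⁻¹ • x
      gcongr
      · refine (norm_add_le _ _).trans ?_
        rw [norm_smul, h1, mul_one, norm_eq_abs]
        have b1 := hM θ h1
        have b2 := hM' θ h1
        have b3 := abs_real_inner_le_norm (gradient h θ) θ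
        rw [h1, mul_one] at b3
        have b4 := abs_sub (a * h θ) (inner ℝ (gradient h θ) θ)
        rw [abs_mul, abs_of_pos (by linarith : 0 < a)] at b4
        nlinarith [abs_nonneg (h θ)]
      · exact exp1 _ (norm_nonneg _)
  · rw [integral_gs]
    have := polar_prod (fun r => exp (-r ^ 2 / 2) * r ^ a) h
    rw [hm, mul_zero] at this
    rw [← this]
    congr 1
    ext x
    rw [hext, mul_assoc]

lemma sphere_poincare0 [Nontrivial E] (h : E → ℝ) (hh : ContDiff ℝ 1 h)
    (hm : ∫ θ : Metric.sphere (0 : E) 1, h θ ∂((volume : Measure E).toSphere) = 0) :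
    (Module.finrank ℝ E - 1) *
      ∫ θ : Metric.sphere (0 : E) 1, h θ ^ 2 ∂((volume : Measure E).toSphere) ≤
    ∫ θ : Metric.sphere (0 : E) 1, (‖gradient h θ‖ ^ 2 - inner ℝ (gradient h θ) (θ : E) ^ 2)
      ∂((volume : Measure E).toSphere) := by
  set V := ∫ θ : Metric.sphere (0 : E) 1, h θ ^ 2 ∂((volume : Measure E).toSphere)
  have hc : Filter.Tendsto (fun a : ℝ => (Module.finrank ℝ E + 2 * a - 2 - a ^ 2) * V)
      (nhdsWithin 1 (Ioi 1)) (nhds ((Module.finrank ℝ E + 2 * 1 - 2 - 1 ^ 2) * V)) :=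
    (Continuous.tendsto (by fun_prop) 1).mono_left nhdsWithin_le_nhds
  rw [show (Module.finrank ℝ E + 2 * 1 - 2 - 1 ^ 2 : ℝ) = Module.finrank ℝ E - 1 by ring] at hc
  refine le_of_tendsto hc ?_
  filter_upwards [Ioc_mem_nhdsGT (show (1 : ℝ) < 2 by norm_num)] with a ha
  exact sphere_poincare_aux h hh hm a ha.1 ha.2

end SpherePart

section HardyPart
open Real Set
variable {E : Type*} [NormedAddCommGroup E] [InnerProductSpace ℝ E] [FiniteDimensional ℝ E]
  [MeasurableSpace E] [BorelSpace E]

lemma sphere_cont (K : ℝ → E → ℝ) (hK : Continuous (Function.uncurry K)) :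
    Continuous fun r => ∫ θ : Metric.sphere (0 : E) 1, K r θ ∂((volume : Measure E).toSphere) := by
  have := continuous_parametric_integral_of_continuous (μ := (volume : Measure E).toSphere)
    (f := fun (r : ℝ) (θ : Metric.sphere (0 : E) 1) => K r θ)
    (hK.comp (continuous_fst.prodMk (continuous_subtype_val.comp continuous_snd))) isCompact_univ
  simpa using this

lemma sphere_integrable (k : E → ℝ) (hk : Continuous k) :
    Integrable (fun θ : Metric.sphere (0 : E) 1 => k θ) ((volume : Measure E).toSphere) := by
  have := (hk.comp (continuous_subtype_val (p := (· ∈ Metric.sphere (0 : E) 1)))).continuousOn.integrableOn_compact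
    (μ := (volume : Measure E).toSphere) isCompact_univ
  rwa [integrableOn_univ] at this

lemma int_cpt (g : ℝ → ℝ) (hg : Continuous g) (R : ℝ) (hR : ∀ r, R ≤ r → g r = 0) :
    IntegrableOn g (Ioi 0) := by
  have h1 : IntegrableOn g (Icc 0 R) := hg.continuousOn.integrableOn_compact isCompact_Icc
  refine h1.of_forall_diff_eq_zero measurableSet_Ioi ?_
  intro x hx
  apply hR
  by_contra h
  exact hx.2 ⟨le_of_lt hx.1, by linarith⟩

lemma integrable_volumeIoiPow (k : ℕ) (φ : ℝ → ℝ)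
    (h : IntegrableOn (fun r => r ^ k * φ r) (Ioi 0)) :
    Integrable (fun r : Ioi (0 : ℝ) => φ r) (Measure.volumeIoiPow k) := by
  simp only [Measure.volumeIoiPow, ENNReal.ofReal]
  rw [integrable_withDensity_iff_integrable_smul
    (measurable_subtype_coe.pow_const _).real_toNNReal]
  have h2 := (integrableOn_iff_comap_subtypeVal measurableSet_Ioi).1 h
  refine h2.congr (.of_forall fun r => ?_)
  simp only [Function.comp]
  rw [NNReal.smul_def, Real.coe_toNNReal _ (pow_nonneg (le_of_lt r.2) _), smul_eq_mul]

lemma polar_K [Nontrivial E] (F : E → ℝ) (K : ℝ → E → ℝ) (hK : Continuous (Function.uncurry K))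
    (R : ℝ) (hR : ∀ r θ, R ≤ r → ‖θ‖ = 1 → K r θ = 0)
    (hF : ∀ r θ, 0 < r → ‖θ‖ = 1 → r ^ (Module.finrank ℝ E - 1) * F (r • θ) = K r θ) :
    ∫ x, F x = ∫ r in Ioi (0 : ℝ), ∫ θ : Metric.sphere (0 : E) 1, K r θ
      ∂((volume : Measure E).toSphere) := by
  set k := Module.finrank ℝ E - 1
  have hF' : ∀ z : Metric.sphere (0 : E) 1 × Ioi (0 : ℝ),
      F ((z.2 : ℝ) • (z.1 : E)) = ((z.2 : ℝ) ^ k)⁻¹ * K z.2 z.1 := by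
    intro z
    have hr : (0 : ℝ) < z.2 := z.2.2
    rw [← hF z.2 z.1 hr (by simp)]
    field_simp
  rw [polar_general]
  simp only [hF']
  rw [integral_prod_symm]
  · simp only [integral_const_mul]
    rw [integral_volumeIoiPow k (fun r => (r ^ k)⁻¹ * ∫ θ : Metric.sphere (0 : E) 1, K r θ
      ∂((volume : Measure E).toSphere))]
    refine setIntegral_congr_fun measurableSet_Ioi fun r hr => ?_
    have hr : (0 : ℝ) < r := hr
    field_simp
  · have hc : Continuous fun z : Metric.sphere (0 : E) 1 × Ioi (0 : ℝ) =>
        ((z.2 : ℝ) ^ k)⁻¹ * K z.2 z.1 := by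
      refine Continuous.mul (Continuous.inv₀ (by fun_prop) fun z => ?_) ?_
      · have hr : (0 : ℝ) < z.2 := z.2.2
        positivity
      · exact hK.comp (((continuous_subtype_val.comp continuous_snd)).prodMk
          (continuous_subtype_val.comp continuous_fst))
    rw [integrable_prod_iff' hc.aestronglyMeasurable]
    constructor
    · refine .of_forall fun r => ?_
      exact (sphere_integrable (K r) (Continuous.comp (g := Function.uncurry K)
        (f := fun θ : E => ((r : ℝ), θ)) hK (by fun_prop))).const_mul (((r : ℝ) ^ k)⁻¹)
    · simp only [norm_mul, integral_const_mul]
      refine integrable_volumeIoiPow k (fun r => ‖(r ^ k)⁻¹‖ * ∫ θ : Metric.sphere (0 : E) 1,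
        ‖K r θ‖ ∂((volume : Measure E).toSphere)) ?_
      have h1 := int_cpt _ (sphere_cont (fun r θ => ‖K r θ‖) hK.norm) R ?_
      · refine h1.congr_fun (fun r hr => ?_) measurableSet_Ioi
        have hr : (0 : ℝ) < r := hr
        rw [norm_of_nonneg (by positivity)]
        field_simp
      · intro r hr
        have : ∀ θ : Metric.sphere (0 : E) 1, ‖K r θ‖ = 0 := fun θ => by
          rw [hR r θ hr (by simp), norm_zero]
        simp [this]

lemma hasDerivAt_ray (u : E → ℝ) (hu : Differentiable ℝ u) (θ : E) (r : ℝ) :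
    HasDerivAt (fun r : ℝ => u (r • θ)) (inner ℝ (gradient u (r • θ)) θ) r := by
  rw [← fderiv_eq_inner_gradient]
  have h1 : HasDerivAt (fun r : ℝ => r • θ) θ r := by
    simpa using (hasDerivAt_id r).smul_const θ
  exact HasFDerivAt.comp_hasDerivAt (f := fun r : ℝ => r • θ) r (hu _).hasFDerivAt h1

lemma continuous_gradient' (u : E → ℝ) (hu : ContDiff ℝ 1 u) : Continuous (gradient u) :=
    (InnerProductSpace.toDual ℝ E).symm.continuous.comp (hu.continuous_fderiv (by simp))

lemma sphere_deriv (u : E → ℝ) (hu : ContDiff ℝ 1 u) (r : ℝ) :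
    HasDerivAt (fun r : ℝ => ∫ θ : Metric.sphere (0 : E) 1, u (r • (θ : E))
      ∂((volume : Measure E).toSphere))
      (∫ θ : Metric.sphere (0 : E) 1, inner ℝ (gradient u (r • (θ : E))) (θ : E)
        ∂((volume : Measure E).toSphere)) r := by
  have hG := continuous_gradient' u hu
  have hc := hu.continuous
  obtain ⟨M, hM⟩ := ((isCompact_closedBall r 1).prod (isCompact_sphere (0 : E) 1)).exists_bound_of_continuousOn
    (f := fun z : ℝ × E => (inner ℝ (gradient u (z.1 • z.2)) z.2 : ℝ)) (by fun_prop)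
  refine (hasDerivAt_integral_of_dominated_loc_of_deriv_le
    (μ := (volume : Measure E).toSphere) (F := fun (r : ℝ) (θ : Metric.sphere (0 : E) 1) => u (r • (θ : E)))
    (F' := fun (r : ℝ) (θ : Metric.sphere (0 : E) 1) => (inner ℝ (gradient u (r • (θ : E))) (θ : E) : ℝ))
    (bound := fun _ => M) (Metric.closedBall_mem_nhds r one_pos) ?_ ?_ ?_ ?_ ?_ ?_).2
  · refine .of_forall fun s => Continuous.aestronglyMeasurable (by fun_prop)
  · exact sphere_integrable (fun θ => u (r • θ)) (by fun_prop)
  · exact Continuous.aestronglyMeasurable (by fun_prop)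
  · refine .of_forall fun θ s hs => ?_
    exact hM (s, θ) ⟨hs, θ.2⟩
  · exact integrable_const _
  · refine .of_forall fun θ s hs => ?_
    exact hasDerivAt_ray u (hu.differentiable (by simp)) θ s

lemma gradient_sq (u : E → ℝ) (hu : Differentiable ℝ u) (x : E) :
    gradient (fun x => u x ^ 2) x = (2 * u x) • gradient u x := by
  apply ext_inner_right ℝ
  intro v
  rw [← fderiv_eq_inner_gradient, inner_smul_left, ← fderiv_eq_inner_gradient,
    ((hu x).hasFDerivAt.pow 2).fderiv]
  simp

lemma gradient_dil (u : E → ℝ) (hu : Differentiable ℝ u) (r c : ℝ) (x : E) :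
    gradient (fun x => u (r • x) - c) x = r • gradient u (r • x) := by
  apply ext_inner_right ℝ
  intro v
  have h1 : HasFDerivAt (fun x : E => r • x) (r • ContinuousLinearMap.id ℝ E) x :=
    (hasFDerivAt_id x).const_smul r
  have h2 : HasFDerivAt (fun x : E => u (r • x)) _ x :=
    HasFDerivAt.comp (f := fun x : E => r • x) x (hu (r • x)).hasFDerivAt h1
  rw [← fderiv_eq_inner_gradient, inner_smul_left, ← fderiv_eq_inner_gradient,
    (h2.sub_const c).fderiv]
  simp

/-- spherical mean -/
noncomputable def sMean (u : E → ℝ) (r : ℝ) : ℝ :=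
  (((volume : Measure E).toSphere univ).toReal)⁻¹ *
    ∫ θ : Metric.sphere (0 : E) 1, u (r • (θ : E)) ∂((volume : Measure E).toSphere)

noncomputable def sA (u : E → ℝ) (r : ℝ) : ℝ :=
    ∫ θ : Metric.sphere (0 : E) 1, (u (r • (θ : E)) - sMean u r) ^ 2 ∂((volume : Measure E).toSphere)

noncomputable def sG (u : E → ℝ) (r : ℝ) : ℝ :=
    ∫ θ : Metric.sphere (0 : E) 1, ‖gradient u (r • (θ : E))‖ ^ 2 ∂((volume : Measure E).toSphere)

lemma omega_pos [Nontrivial E] : 0 < ((volume : Measure E).toSphere univ).toReal := by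
  rw [Measure.toSphere_apply_univ, ENNReal.toReal_mul]
  have h1 := ENNReal.toReal_pos (Metric.measure_ball_pos (volume : Measure E) 0 one_pos).ne'
    measure_ball_lt_top.ne
  have h2 : 0 < Module.finrank ℝ E := Module.finrank_pos
  simp only [ENNReal.toReal_natCast]
  positivity

lemma continuous_sMean (u : E → ℝ) (hu : Continuous u) : Continuous (sMean u) :=
  continuous_const.mul (sphere_cont (fun r θ => u (r • θ)) (by fun_prop))

lemma continuous_sA (u : E → ℝ) (hu : Continuous u) : Continuous (sA u) := by
  have := continuous_sMean u hu
  exact sphere_cont (fun r θ => (u (r • θ) - sMean u r) ^ 2) (by fun_prop)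

lemma continuous_sG (u : E → ℝ) (hu : ContDiff ℝ 1 u) : Continuous (sG u) := by
  have := continuous_gradient' u hu
  exact sphere_cont (fun r θ => ‖gradient u (r • θ)‖ ^ 2) (by fun_prop)

lemma sphere_hardy [Nontrivial E] (u : E → ℝ) (hu : ContDiff ℝ 1 u) (R : ℝ) (hR0 : 0 < R)
    (hR : ∀ x, R ≤ ‖x‖ → u x = 0) (hR' : ∀ x, R ≤ ‖x‖ → gradient u x = 0)
    (k : ℕ) (hk : Module.finrank ℝ E = k + 3) :
    ((k + 3 : ℝ) ^ 2 / 4) * ∫ r in Ioi (0 : ℝ), r ^ k * sA u r ≤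
      ∫ r in Ioi (0 : ℝ), r ^ (k + 2) * sG u r := by
  have hd : Differentiable ℝ u := hu.differentiable (by simp)
  have hG := continuous_gradient' u hu
  have hc := hu.continuous
  set σ := (volume : Measure E).toSphere with hσ
  set ω := (σ univ).toReal with hω
  have hωpos : 0 < ω := omega_pos
  let U : ℝ → ℝ := fun r => ∫ θ : Metric.sphere (0 : E) 1, u (r • (θ : E)) ∂σ
  let U1 : ℝ → ℝ := fun r => ∫ θ : Metric.sphere (0 : E) 1, inner ℝ (gradient u (r • (θ : E))) (θ : E) ∂σ
  let Q : ℝ → ℝ := fun r => ∫ θ : Metric.sphere (0 : E) 1, u (r • (θ : E)) ^ 2 ∂σ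
  let T : ℝ → ℝ := fun r => ∫ θ : Metric.sphere (0 : E) 1, u (r • (θ : E)) * inner ℝ (gradient u (r • (θ : E))) (θ : E) ∂σ
  let B : ℝ → ℝ := fun r => ∫ θ : Metric.sphere (0 : E) 1, inner ℝ (gradient u (r • (θ : E))) (θ : E) ^ 2 ∂σ
  have hm : ∀ r, sMean u r = ω⁻¹ * U r := fun r => rfl
  have cU : Continuous U := sphere_cont (fun r θ => u (r • θ)) (by fun_prop)
  have cU1 : Continuous U1 := sphere_cont (fun r θ => inner ℝ (gradient u (r • θ)) θ) (by fun_prop)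
  have cT : Continuous T := sphere_cont (fun r θ => u (r • θ) * inner ℝ (gradient u (r • θ)) θ) (by fun_prop)
  have cA := continuous_sA u hc
  have cG := continuous_sG u hu
  have Rn : ∀ r (θ : Metric.sphere (0 : E) 1), R ≤ r → R ≤ ‖r • (θ : E)‖ := by
    intro r θ hr
    simp [norm_smul]
    exact hr.trans (le_abs_self r)
  have U0 : ∀ r, R ≤ r → U r = 0 := fun r hr => by simp [U, hR _ (Rn r _ hr)]
  have T0 : ∀ r, R ≤ r → T r = 0 := fun r hr => by simp only [T, hR _ (Rn r _ hr), zero_mul, integral_zero]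
  have A0 : ∀ r, R ≤ r → sA u r = 0 := fun r hr => by simp [sA, hm, U0 r hr, hR _ (Rn r _ hr)]
  have G0 : ∀ r, R ≤ r → sG u r = 0 := fun r hr => by simp [sG, hR' _ (Rn r _ hr)]
  -- integrability shortcuts
  have iu : ∀ r : ℝ, Integrable (fun θ : Metric.sphere (0 : E) 1 => u (r • (θ : E))) σ :=
    fun r => sphere_integrable (fun θ => u (r • θ)) (by fun_prop)
  have iu2 : ∀ r : ℝ, Integrable (fun θ : Metric.sphere (0 : E) 1 => u (r • (θ : E)) ^ 2) σ :=
    fun r => sphere_integrable (fun θ => u (r • θ) ^ 2) (by fun_prop)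
  have iD : ∀ r : ℝ, Integrable (fun θ : Metric.sphere (0 : E) 1 => (inner ℝ (gradient u (r • (θ : E))) (θ : E) : ℝ)) σ :=
    fun r => sphere_integrable (fun θ => inner ℝ (gradient u (r • θ)) θ) (by fun_prop)
  have iD2 : ∀ r : ℝ, Integrable (fun θ : Metric.sphere (0 : E) 1 => (inner ℝ (gradient u (r • (θ : E))) (θ : E) : ℝ) ^ 2) σ :=
    fun r => sphere_integrable (fun θ => inner ℝ (gradient u (r • θ)) θ ^ 2) (by fun_prop)
  have iT : ∀ r : ℝ, Integrable (fun θ : Metric.sphere (0 : E) 1 => u (r • (θ : E)) * (inner ℝ (gradient u (r • (θ : E))) (θ : E) : ℝ)) σ :=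
    fun r => sphere_integrable (fun θ => u (r • θ) * inner ℝ (gradient u (r • θ)) θ) (by fun_prop)
  have iG : ∀ r : ℝ, Integrable (fun θ : Metric.sphere (0 : E) 1 => ‖gradient u (r • (θ : E))‖ ^ 2) σ :=
    fun r => sphere_integrable (fun θ => ‖gradient u (r • θ)‖ ^ 2) (by fun_prop)
  have hconst : ∀ c : ℝ, ∫ θ : Metric.sphere (0 : E) 1, c ∂σ = ω * c := by
    intro c
    simp [hω, Measure.real]
  have hA : ∀ r, sA u r = Q r - ω⁻¹ * U r ^ 2 := by
    intro r
    have : sA u r = ∫ θ : Metric.sphere (0 : E) 1, ((u (r • (θ : E)) ^ 2 - (2 * (ω⁻¹ * U r)) * u (r • (θ : E))) + (ω⁻¹ * U r) ^ 2) ∂σ := by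
      rw [sA]
      congr 1
      ext θ
      rw [hm]
      ring
    have j1 : Integrable (fun θ : Metric.sphere (0 : E) 1 =>
        u (r • (θ : E)) ^ 2 - (2 * (ω⁻¹ * U r)) * u (r • (θ : E))) σ :=
      (iu2 r).sub ((iu r).const_mul _)
    rw [this, integral_add j1 (integrable_const _),
      integral_sub (iu2 r) ((iu r).const_mul _), integral_const_mul, hconst]
    change Q r - 2 * (ω⁻¹ * U r) * U r + _ = _
    field_simp
    ring
  have dA : ∀ r, HasDerivAt (sA u) (2 * T r - 2 * ω⁻¹ * U r * U1 r) r := by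
    intro r
    have h1 := sphere_deriv u hu r
    have h2 := sphere_deriv (fun x => u x ^ 2) (hu.pow 2) r
    have h3 := h2.sub ((h1.pow 2).const_mul ω⁻¹)
    have h4 : HasDerivAt (sA u) _ r := h3.congr_of_eventuallyEq (.of_forall fun s => hA s)
    refine h4.congr_deriv ?_
    have : ∫ θ : Metric.sphere (0 : E) 1, inner ℝ (gradient (fun x => u x ^ 2) (r • (θ : E))) (θ : E) ∂σ = 2 * T r := by
      rw [← integral_const_mul]
      congr 1
      ext θ
      rw [gradient_sq u hd, inner_smul_left, conj_trivial, mul_assoc]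
    rw [this]
    change 2 * T r - ω⁻¹ * ((2 : ℕ) * U r ^ (2 - 1) * U1 r) = _
    push_cast
    ring
  have P : ∀ r, (k + 2 : ℝ) * sA u r ≤ r ^ 2 * (sG u r - B r) := by
    intro r
    have h0 : ∫ θ : Metric.sphere (0 : E) 1, (u (r • (θ : E)) - sMean u r) ∂σ = 0 := by
      rw [integral_sub (iu r) (integrable_const _), hconst, hm, mul_inv_cancel_left₀ hωpos.ne']
      exact sub_self _
    have h1 := sphere_poincare0 (fun x => u (r • x) - sMean u r) (by fun_prop) h0
    rw [hk] at h1
    push_cast at h1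
    rw [show (k + 3 - 1 : ℝ) = k + 2 by ring] at h1
    refine h1.trans_eq ?_
    change _ = r ^ 2 * ((∫ θ : Metric.sphere (0 : E) 1, ‖gradient u (r • (θ : E))‖ ^ 2 ∂σ) - ∫ θ : Metric.sphere (0 : E) 1, inner ℝ (gradient u (r • (θ : E))) (θ : E) ^ 2 ∂σ)
    rw [← integral_sub (iG r) (iD2 r), ← integral_const_mul]
    congr 1
    ext θ
    rw [gradient_dil u hd, norm_smul, inner_smul_left, conj_trivial, mul_pow, mul_pow, norm_eq_abs, sq_abs]
    ring
  set c : ℝ := (k + 1) / 2 with hcdef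
  have S : ∀ r, 0 ≤ r ^ 2 * B r + c * r * (2 * T r - 2 * ω⁻¹ * U r * U1 r) + c ^ 2 * sA u r := by
    intro r
    have h1 : 0 ≤ ∫ θ : Metric.sphere (0 : E) 1, (r * inner ℝ (gradient u (r • (θ : E))) (θ : E) + c * (u (r • (θ : E)) - sMean u r)) ^ 2 ∂σ :=
      integral_nonneg fun θ => sq_nonneg _
    refine h1.trans_eq ?_
    have iA : Integrable (fun θ : Metric.sphere (0 : E) 1 => (u (r • (θ : E)) - sMean u r) ^ 2) σ :=
      sphere_integrable (fun θ => (u (r • θ) - sMean u r) ^ 2) (by fun_prop)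
    have : ∀ θ : Metric.sphere (0 : E) 1, (r * inner ℝ (gradient u (r • (θ : E))) (θ : E) + c * (u (r • (θ : E)) - sMean u r)) ^ 2 =
      r ^ 2 * inner ℝ (gradient u (r • (θ : E))) (θ : E) ^ 2 + (2 * c * r) * (u (r • (θ : E)) * inner ℝ (gradient u (r • (θ : E))) (θ : E)) - (2 * c * r * (ω⁻¹ * U r)) * inner ℝ (gradient u (r • (θ : E))) (θ : E) + c ^ 2 * (u (r • (θ : E)) - sMean u r) ^ 2 := by
      intro θ
      rw [hm]
      ring
    simp only [this]
    have j1 : Integrable (fun θ : Metric.sphere (0 : E) 1 =>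
        r ^ 2 * inner ℝ (gradient u (r • (θ : E))) (θ : E) ^ 2 + (2 * c * r) *
        (u (r • (θ : E)) * inner ℝ (gradient u (r • (θ : E))) (θ : E))) σ :=
      (iD2 r).const_mul _ |>.add ((iT r).const_mul _)
    have j2 : Integrable (fun θ : Metric.sphere (0 : E) 1 =>
        r ^ 2 * inner ℝ (gradient u (r • (θ : E))) (θ : E) ^ 2 + (2 * c * r) *
        (u (r • (θ : E)) * inner ℝ (gradient u (r • (θ : E))) (θ : E)) -
        (2 * c * r * (ω⁻¹ * U r)) * inner ℝ (gradient u (r • (θ : E))) (θ : E)) σ :=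
      j1.sub ((iD r).const_mul _)
    rw [integral_add j2 (iA.const_mul _), integral_sub j1 ((iD r).const_mul _),
      integral_add ((iD2 r).const_mul _) ((iT r).const_mul _)]
    simp only [integral_const_mul]
    change r ^ 2 * B r + 2 * c * r * T r - 2 * c * r * (ω⁻¹ * U r) * U1 r + c ^ 2 * sA u r = _
    ring
  let g' : ℝ → ℝ := fun r => c * ((k + 1) * r ^ k * sA u r + r ^ (k + 1) * (2 * T r - 2 * ω⁻¹ * U r * U1 r))
  have dg : ∀ r ∈ Ici (0 : ℝ), HasDerivAt (fun r => c * (r ^ (k + 1) * sA u r)) (g' r) r := by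
    intro r _
    have := (((hasDerivAt_pow (k + 1) r).mul (dA r)).const_mul c)
    refine this.congr_deriv ?_
    simp [g']
  have ig' : IntegrableOn g' (Ioi 0) := int_cpt g' (by fun_prop) R fun r hr => by
    simp [g', A0 r hr, T0 r hr, U0 r hr]
  have hint := integral_Ioi_of_hasDerivAt_of_tendsto' dg ig' (m := 0)
    (tendsto_const_nhds.congr' (by
      filter_upwards [Filter.eventually_ge_atTop R] with r hr
      simp [A0 r hr]))
  simp only [ne_eq, Nat.add_eq_zero_iff, one_ne_zero, and_false, not_false_eq_true, zero_pow,
    zero_mul, mul_zero, sub_zero] at hint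
  have iAr : IntegrableOn (fun r => r ^ k * sA u r) (Ioi 0) :=
    int_cpt _ (by fun_prop) R fun r hr => by simp [A0 r hr]
  have iGr : IntegrableOn (fun r => r ^ (k + 2) * sG u r) (Ioi 0) :=
    int_cpt _ (by fun_prop) R fun r hr => by simp [G0 r hr]
  have key : ∫ r in Ioi (0 : ℝ), (((k + 3 : ℝ) ^ 2 / 4) * (r ^ k * sA u r) - g' r) ≤
      ∫ r in Ioi (0 : ℝ), r ^ (k + 2) * sG u r := by
    refine setIntegral_mono_on ((iAr.const_mul _).sub ig') iGr measurableSet_Ioi fun r hr => ?_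
    have hr : (0 : ℝ) < r := hr
    have h1 := mul_le_mul_of_nonneg_left (P r) (pow_nonneg hr.le k)
    have h2 := mul_nonneg (pow_nonneg hr.le k) (S r)
    have : r ^ (k + 2) * sG u r - (((k + 3 : ℝ) ^ 2 / 4) * (r ^ k * sA u r) - g' r) =
      (r ^ k * (r ^ 2 * (sG u r - B r)) - r ^ k * ((k + 2 : ℝ) * sA u r)) +
       r ^ k * (r ^ 2 * B r + c * r * (2 * T r - 2 * ω⁻¹ * U r * U1 r) + c ^ 2 * sA u r) := by
      simp only [g', hcdef]
      ring
    linarith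
  rw [integral_sub (iAr.const_mul _) ig', integral_const_mul, hint, sub_zero] at key
  exact key

end HardyPart

lemma sum_fderiv_sq (n : ℕ) (u : EuclideanSpace ℝ (Fin n) → ℝ) (x : EuclideanSpace ℝ (Fin n)) :
    ∑ j : Fin n, (fderiv ℝ u x (EuclideanSpace.single j 1)) ^ 2 = ‖gradient u x‖ ^ 2 := by
  rw [EuclideanSpace.norm_sq_eq]
  refine Finset.sum_congr rfl fun j _ => ?_
  rw [fderiv_eq_inner_gradient, EuclideanSpace.inner_single_right]
  simp

lemma gradient_zero_of_notMem_tsupport (n : ℕ) (u : EuclideanSpace ℝ (Fin n) → ℝ)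
    (x : EuclideanSpace ℝ (Fin n)) (hx : x ∉ tsupport u) : gradient u x = 0 := by
  have h : fderiv ℝ u x = 0 := by
    by_contra h
    exact hx (support_fderiv_subset ℝ h)
  simp [gradient, h]

lemma fderiv_normSq (n : ℕ) (f : EuclideanSpace ℝ (Fin n) → ℂ) (hf : Differentiable ℝ f)
    (x v : EuclideanSpace ℝ (Fin n)) :
    ‖fderiv ℝ f x v‖ ^ 2 = (fderiv ℝ (fun x => (f x).re) x v) ^ 2 +
      (fderiv ℝ (fun x => (f x).im) x v) ^ 2 := by
  have h1 : HasFDerivAt (fun x => (f x).re) _ x :=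
    Complex.reCLM.hasFDerivAt.comp x (hf x).hasFDerivAt
  have h2 : HasFDerivAt (fun x => (f x).im) _ x :=
    Complex.imCLM.hasFDerivAt.comp x (hf x).hasFDerivAt
  rw [h1.fderiv, h2.fderiv, Complex.sq_norm, Complex.normSq_apply]
  simp
  ring

lemma sphericalAvg_sub_normSq (n : ℕ) (f : EuclideanSpace ℝ (Fin n) → ℂ) (hf : Continuous f)
    (x : EuclideanSpace ℝ (Fin n)) :
    ‖f x - sphericalAvg n f x‖ ^ 2 = ((f x).re - sMean (fun x => (f x).re) ‖x‖) ^ 2 +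
      ((f x).im - sMean (fun x => (f x).im) ‖x‖) ^ 2 := by
  have hi : Integrable (fun θ : Metric.sphere (0 : EuclideanSpace ℝ (Fin n)) 1 =>
      f (‖x‖ • (θ : EuclideanSpace ℝ (Fin n))))
      ((volume : Measure (EuclideanSpace ℝ (Fin n))).toSphere) := by
    have hc : Continuous (fun θ : Metric.sphere (0 : EuclideanSpace ℝ (Fin n)) 1 =>
      f (‖x‖ • (θ : EuclideanSpace ℝ (Fin n)))) := by fun_prop
    have := hc.continuousOn.integrableOn_compact
      (μ := (volume : Measure (EuclideanSpace ℝ (Fin n))).toSphere) isCompact_univ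
    rwa [integrableOn_univ] at this
  have h1 : (sphericalAvg n f x).re = sMean (fun x => (f x).re) ‖x‖ := by
    rw [sphericalAvg, Complex.smul_re, sMean, sphereArea, smul_eq_mul]
    congr 1
    exact (Complex.reCLM.integral_comp_comm hi).symm
  have h2 : (sphericalAvg n f x).im = sMean (fun x => (f x).im) ‖x‖ := by
    rw [sphericalAvg, Complex.smul_im, sMean, sphereArea, smul_eq_mul]
    congr 1
    exact (Complex.imCLM.integral_comp_comm hi).symm
  rw [Complex.sq_norm, Complex.normSq_apply, Complex.sub_re, Complex.sub_im, h1, h2]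
  ring

/-- **Improved Hardy inequality for the non-radial part**: for `n ≥ 3` and
`f ∈ C₀^∞(ℝⁿ)`, with `P` the spherical averaging projection and `P^⊥ = Id - P`,
`(n²/4) ∫ |x|⁻² |P^⊥ f|² dx ≤ ∫ |∇f|² dx`. -/
theorem improved_hardy_nonradial (n : ℕ) (hn : 3 ≤ n)
    (f : EuclideanSpace ℝ (Fin n) → ℂ)
    (hf : ContDiff ℝ (⊤ : ℕ∞) f) (hsupp : HasCompactSupport f) :
    (n : ℝ) ^ 2 / 4 *
        ∫ x : EuclideanSpace ℝ (Fin n), (‖x‖ ^ 2)⁻¹ * ‖f x - sphericalAvg n f x‖ ^ 2 ≤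
      ∫ x : EuclideanSpace ℝ (Fin n),
        ∑ j : Fin n, ‖fderiv ℝ f x (EuclideanSpace.single j 1)‖ ^ 2 := by
  obtain ⟨k, rfl⟩ : ∃ k, n = k + 3 := ⟨n - 3, by omega⟩
  have hfr : Module.finrank ℝ (EuclideanSpace ℝ (Fin (k + 3))) = k + 3 := by simp
  have hf1 : ContDiff ℝ 1 f := hf.of_le (by exact_mod_cast le_top)
  have hfd : Differentiable ℝ f := hf1.differentiable (by simp)
  have hfc : Continuous f := hf1.continuous
  obtain ⟨R, hR0, hR⟩ : ∃ R : ℝ, 0 < R ∧ ∀ x, R ≤ ‖x‖ → x ∉ tsupport f := by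
    obtain ⟨R, hR⟩ := hsupp.isCompact.isBounded.exists_norm_le
    refine ⟨|R| + 1, by positivity, fun x hx hx' => ?_⟩
    have := hR x hx'
    linarith [le_abs_self R]
  have hf0 : ∀ x, R ≤ ‖x‖ → f x = 0 := fun x hx => image_eq_zero_of_notMem_tsupport (hR x hx)
  set u : EuclideanSpace ℝ (Fin (k + 3)) → ℝ := fun x => (f x).re with hu
  set v : EuclideanSpace ℝ (Fin (k + 3)) → ℝ := fun x => (f x).im with hv
  have hu1 : ContDiff ℝ 1 u := Complex.reCLM.contDiff.comp hf1
  have hv1 : ContDiff ℝ 1 v := Complex.imCLM.contDiff.comp hf1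
  have hu0 : ∀ x, R ≤ ‖x‖ → u x = 0 := fun x hx => by simp [hu, hf0 x hx]
  have hv0 : ∀ x, R ≤ ‖x‖ → v x = 0 := fun x hx => by simp [hv, hf0 x hx]
  have tu : tsupport u ⊆ tsupport f := tsupport_comp_subset (g := Complex.re) Complex.zero_re f
  have tv : tsupport v ⊆ tsupport f := tsupport_comp_subset (g := Complex.im) Complex.zero_im f
  have hgu0 : ∀ x, R ≤ ‖x‖ → gradient u x = 0 := fun x hx =>
    gradient_zero_of_notMem_tsupport _ u x fun h => hR x hx (tu h)
  have hgv0 : ∀ x, R ≤ ‖x‖ → gradient v x = 0 := fun x hx =>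
    gradient_zero_of_notMem_tsupport _ v x fun h => hR x hx (tv h)
  have cmu := continuous_sMean u hu1.continuous
  have cmv := continuous_sMean v hv1.continuous
  have cu := hu1.continuous
  have cv := hv1.continuous
  have cgu := continuous_gradient' u hu1
  have cgv := continuous_gradient' v hv1
  have cAu := continuous_sA u cu
  have cAv := continuous_sA v cv
  have cGu := continuous_sG u hu1
  have cGv := continuous_sG v hv1
  have Rn : ∀ r (θ : EuclideanSpace ℝ (Fin (k + 3))), R ≤ r → ‖θ‖ = 1 → R ≤ ‖r • θ‖ := by
    intro r θ hr hθ
    rw [norm_smul, hθ, mul_one]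
    exact hr.trans (le_abs_self r)
  have mu0 : ∀ r, R ≤ r → sMean u r = 0 := fun r hr => by
    have : ∀ θ : Metric.sphere (0 : EuclideanSpace ℝ (Fin (k + 3))) 1, u (r • (θ : EuclideanSpace ℝ (Fin (k + 3)))) = 0 :=
      fun θ => hu0 _ (Rn r θ hr (by simp))
    simp [sMean, this]
  have mv0 : ∀ r, R ≤ r → sMean v r = 0 := fun r hr => by
    have : ∀ θ : Metric.sphere (0 : EuclideanSpace ℝ (Fin (k + 3))) 1, v (r • (θ : EuclideanSpace ℝ (Fin (k + 3)))) = 0 :=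
      fun θ => hv0 _ (Rn r θ hr (by simp))
    simp [sMean, this]
  have I1 := polar_K (fun x => (‖x‖ ^ 2)⁻¹ * ‖f x - sphericalAvg (k + 3) f x‖ ^ 2)
    (fun r θ => r ^ k * ((u (r • θ) - sMean u r) ^ 2 + (v (r • θ) - sMean v r) ^ 2))
    (by fun_prop) R
    (fun r θ hr hθ => by
      simp [hu0 _ (Rn r θ hr hθ), hv0 _ (Rn r θ hr hθ), mu0 r hr, mv0 r hr])
    (fun r θ hr hθ => by
      simp only [sphericalAvg_sub_normSq (k + 3) f hfc, hfr]
      rw [norm_smul, hθ, mul_one, Real.norm_of_nonneg hr.le, show k + 3 - 1 = k + 2 by omega]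
      field_simp
      simp only [hu, hv]
      ring)
  have I2 := polar_K (fun x => ∑ j : Fin (k + 3), ‖fderiv ℝ f x (EuclideanSpace.single j 1)‖ ^ 2)
    (fun r θ => r ^ (k + 2) * (‖gradient u (r • θ)‖ ^ 2 + ‖gradient v (r • θ)‖ ^ 2))
    (by fun_prop) R
    (fun r θ hr hθ => by
      rw [hgu0 _ (Rn r θ hr hθ), hgv0 _ (Rn r θ hr hθ)]
      simp)
    (fun r θ hr hθ => by
      simp only [fderiv_normSq (k + 3) f hfd, Finset.sum_add_distrib, sum_fderiv_sq, hfr]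
      rfl)
  rw [I1, I2]
  have e1 : ∀ r : ℝ, ∫ θ : Metric.sphere (0 : EuclideanSpace ℝ (Fin (k + 3))) 1,
      r ^ k * ((u (r • (θ : EuclideanSpace ℝ (Fin (k + 3)))) - sMean u r) ^ 2 +
        (v (r • (θ : EuclideanSpace ℝ (Fin (k + 3)))) - sMean v r) ^ 2)
      ∂((volume : Measure (EuclideanSpace ℝ (Fin (k + 3)))).toSphere) =
      r ^ k * sA u r + r ^ k * sA v r := by
    intro r
    rw [integral_const_mul, integral_add
      (sphere_integrable (fun θ => (u (r • θ) - sMean u r) ^ 2) (by fun_prop))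
      (sphere_integrable (fun θ => (v (r • θ) - sMean v r) ^ 2) (by fun_prop)), mul_add]
    rfl
  have e2 : ∀ r : ℝ, ∫ θ : Metric.sphere (0 : EuclideanSpace ℝ (Fin (k + 3))) 1,
      r ^ (k + 2) * (‖gradient u (r • (θ : EuclideanSpace ℝ (Fin (k + 3))))‖ ^ 2 +
        ‖gradient v (r • (θ : EuclideanSpace ℝ (Fin (k + 3))))‖ ^ 2)
      ∂((volume : Measure (EuclideanSpace ℝ (Fin (k + 3)))).toSphere) =
      r ^ (k + 2) * sG u r + r ^ (k + 2) * sG v r := by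
    intro r
    rw [integral_const_mul, integral_add
      (sphere_integrable (fun θ => ‖gradient u (r • θ)‖ ^ 2) (by fun_prop))
      (sphere_integrable (fun θ => ‖gradient v (r • θ)‖ ^ 2) (by fun_prop)), mul_add]
    rfl
  simp only [e1, e2]
  have zA : ∀ w : EuclideanSpace ℝ (Fin (k + 3)) → ℝ, (∀ x, R ≤ ‖x‖ → w x = 0) →
      (∀ r, R ≤ r → sMean w r = 0) → ∀ r, R ≤ r → sA w r = 0 := by
    intro w hw hm r hr
    have : ∀ θ : Metric.sphere (0 : EuclideanSpace ℝ (Fin (k + 3))) 1, w (r • (θ : EuclideanSpace ℝ (Fin (k + 3)))) = 0 :=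
      fun θ => hw _ (Rn r θ hr (by simp))
    simp [sA, this, hm r hr]
  have zG : ∀ w : EuclideanSpace ℝ (Fin (k + 3)) → ℝ, (∀ x, R ≤ ‖x‖ → gradient w x = 0) →
      ∀ r, R ≤ r → sG w r = 0 := by
    intro w hw r hr
    have : ∀ θ : Metric.sphere (0 : EuclideanSpace ℝ (Fin (k + 3))) 1, gradient w (r • (θ : EuclideanSpace ℝ (Fin (k + 3)))) = 0 :=
      fun θ => hw _ (Rn r θ hr (by simp))
    simp [sG, this]
  rw [integral_add
      (int_cpt (fun r => r ^ k * sA u r) (by fun_prop) R fun r hr => by simp [zA u hu0 mu0 r hr])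
      (int_cpt (fun r => r ^ k * sA v r) (by fun_prop) R fun r hr => by simp [zA v hv0 mv0 r hr]),
    integral_add
      (int_cpt (fun r => r ^ (k + 2) * sG u r) (by fun_prop) R fun r hr => by simp [zG u hgu0 r hr])
      (int_cpt (fun r => r ^ (k + 2) * sG v r) (by fun_prop) R fun r hr => by simp [zG v hgv0 r hr])]
  have Hu := sphere_hardy u hu1 R hR0 hu0 hgu0 k hfr
  have Hv := sphere_hardy v hv1 R hR0 hv0 hgv0 k hfr
  push_cast
  rw [mul_add]
  linarith
end

section
/- Let 1 ≤ p, p_1, p_2 < ∞ and 1 ≤ q, q_1, q_2 ≤ ∞ with 1/p = 1/p_1 + 1/p_2 and 1/q = 1/q_1 + 1/q_2. Then there is a constant C such that ‖fg‖_{L^{p,q}(ℝ^n)} ≤ C ‖f‖_{L^{p_1,q_1}(ℝ^n)} ‖g‖_{L^{p_2,q_2}(ℝ^n)} for all measurable f, g. -/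
open MeasureTheory
open scoped ENNReal NNReal

/-- The Lorentz quasinorm `‖f‖_{L^{p,q}} ≍ ‖ t · d_f(t)^{1/p} ‖_{L^q(ℝ₊, dt/t)}`,
where `d_f(t) = vol {x : |f(x)| > t}`; for `q = ∞` it is the weak-`L^p` quasinorm
`sup_{t > 0} t · d_f(t)^{1/p}`. -/
noncomputable def lorentzNorm (n : ℕ) (p : ℝ) (q : ℝ≥0∞)
    (f : EuclideanSpace ℝ (Fin n) → ℂ) : ℝ≥0∞ :=
  if q = ∞ then
    ⨆ t ∈ Set.Ioi (0 : ℝ), ENNReal.ofReal t * (volume {x | t < ‖f x‖}) ^ (1 / p)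
  else
    (∫⁻ t in Set.Ioi (0 : ℝ),
        (ENNReal.ofReal t * (volume {x | t < ‖f x‖}) ^ (1 / p)) ^ q.toReal /
          ENNReal.ofReal t) ^ (1 / q.toReal)


open Set Filter Topology

/-- power weight -/
noncomputable def lorW (a u : ℝ) : ℝ≥0∞ := ENNReal.ofReal u ^ a / ENNReal.ofReal u

theorem lorW_meas (a : ℝ) : Measurable (lorW a) := by unfold lorW; fun_prop

theorem lorW_eq (a u : ℝ) (hu : 0 < u) : lorW a u = ENNReal.ofReal (u ^ (a - 1)) := by
  unfold lorW
  rw [ENNReal.ofReal_rpow_of_pos hu, ← ENNReal.ofReal_div_of_pos hu, Real.rpow_sub_one hu.ne']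

theorem lor_layer_fin (a : ℝ) (ha : 0 < a) (c : ℝ) (hc : 0 ≤ c) :
    ENNReal.ofReal a * ∫⁻ u in Ioi (0 : ℝ),
      (if ENNReal.ofReal u < ENNReal.ofReal c then 1 else 0) * lorW a u = ENNReal.ofReal c ^ a := by
  have h := lintegral_rpow_eq_lintegral_meas_lt_mul (Measure.dirac ()) (f := fun _ => c)
    (ae_of_all _ fun _ => hc) aemeasurable_const ha
  simp only [lintegral_const, measure_univ, mul_one] at h
  rw [ENNReal.ofReal_rpow_of_nonneg hc ha.le, h]
  congr 1
  refine setLIntegral_congr_fun measurableSet_Ioi fun u hu => ?_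
  have hu : 0 < u := hu
  simp only [lorW_eq a u hu, ENNReal.ofReal_lt_ofReal_iff_of_nonneg hu.le]
  by_cases h : u < c <;> simp [h]

theorem lor_layer (a : ℝ) (ha : 0 < a) (X : ℝ≥0∞) :
    ENNReal.ofReal a * ∫⁻ u in Ioi (0 : ℝ),
      (if ENNReal.ofReal u < X then 1 else 0) * lorW a u = X ^ a := by
  by_cases hX : X = ∞
  · subst hX
    rw [ENNReal.top_rpow_of_pos ha, eq_top_iff]
    refine le_of_forall_lt fun c hc => ?_
    have hlim : ENNReal.ofReal ((c.toReal + 1) ^ (1 / a)) ^ a = ENNReal.ofReal (c.toReal + 1) := by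
      rw [ENNReal.ofReal_rpow_of_nonneg (by positivity) ha.le, ← Real.rpow_mul (by positivity)]
      simp [ha.ne']
    have h1 : c < ENNReal.ofReal (c.toReal + 1) := by
      rw [ENNReal.lt_ofReal_iff_toReal_lt hc.ne]; linarith
    rw [← hlim, ← lor_layer_fin a ha _ (by positivity)] at h1
    refine h1.trans_le ?_
    gcongr with u
    split_ifs <;> simp_all
  · lift X to ℝ≥0 using hX
    have := lor_layer_fin a ha X X.2
    simpa only [ENNReal.ofReal_coe_nnreal] using this

theorem lor_fubini (p q : ℝ) (hp : 0 < p) (hq : 0 < q) (D S : ℝ → ℝ≥0∞)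
    (hS : Measurable S)
    (hDS : ∀ t u : ℝ, 0 < t → 0 < u → (ENNReal.ofReal u < D t ↔ ENNReal.ofReal t < S u)) :
    ENNReal.ofReal p * ∫⁻ t in Ioi (0 : ℝ),
      (ENNReal.ofReal t * D t ^ (1 / p)) ^ q / ENNReal.ofReal t =
    ∫⁻ u in Ioi (0 : ℝ), (ENNReal.ofReal u ^ (1 / p) * S u) ^ q / ENNReal.ofReal u := by
  have ha : 0 < q / p := by positivity
  have e1 : ∫⁻ t in Ioi (0 : ℝ), (ENNReal.ofReal t * D t ^ (1 / p)) ^ q / ENNReal.ofReal t =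
      ∫⁻ t in Ioi (0 : ℝ), ENNReal.ofReal (q / p) * ∫⁻ u in Ioi (0 : ℝ),
        lorW q t * ((if ENNReal.ofReal t < S u then 1 else 0) * lorW (q / p) u) := by
    refine setLIntegral_congr_fun measurableSet_Ioi fun t ht => ?_
    have ht : 0 < t := ht
    rw [lintegral_const_mul _ (by
      refine Measurable.mul (Measurable.ite (measurableSet_lt measurable_const hS)
        measurable_const measurable_const) (lorW_meas _)), mul_left_comm]
    have : ∫⁻ u in Ioi (0 : ℝ), ((if ENNReal.ofReal t < S u then 1 else 0) * lorW (q / p) u) =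
       ∫⁻ u in Ioi (0 : ℝ), ((if ENNReal.ofReal u < D t then 1 else 0) * lorW (q / p) u) := by
      refine setLIntegral_congr_fun measurableSet_Ioi fun u hu => ?_
      simp only [hDS t u ht hu]
    rw [this, lor_layer _ ha, ENNReal.mul_rpow_of_nonneg _ _ hq.le, ← ENNReal.rpow_mul, lorW]
    rw [one_div_mul_eq_div, ENNReal.div_eq_inv_mul, ENNReal.div_eq_inv_mul]
    ring
  have e2 : ∫⁻ u in Ioi (0 : ℝ), (ENNReal.ofReal u ^ (1 / p) * S u) ^ q / ENNReal.ofReal u =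
      ∫⁻ u in Ioi (0 : ℝ), ENNReal.ofReal q * ∫⁻ t in Ioi (0 : ℝ),
        lorW q t * ((if ENNReal.ofReal t < S u then 1 else 0) * lorW (q / p) u) := by
    refine setLIntegral_congr_fun measurableSet_Ioi fun u hu => ?_
    have hu : 0 < u := hu
    have : ∀ t, lorW q t * ((if ENNReal.ofReal t < S u then 1 else 0) * lorW (q / p) u) =
      lorW (q / p) u * ((if ENNReal.ofReal t < S u then 1 else 0) * lorW q t) := fun t => by ring
    simp only [this]
    rw [lintegral_const_mul _ (by
      refine Measurable.mul (Measurable.ite (measurableSet_lt (by fun_prop) measurable_const)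
        measurable_const measurable_const) (lorW_meas _)), mul_left_comm, lor_layer _ hq,
        ENNReal.mul_rpow_of_nonneg _ _ hq.le, ← ENNReal.rpow_mul, lorW]
    rw [one_div_mul_eq_div, ENNReal.div_eq_inv_mul, ENNReal.div_eq_inv_mul]
    ring
  have hm : Measurable (Function.uncurry fun t u : ℝ =>
      lorW q t * ((if ENNReal.ofReal t < S u then 1 else 0) * lorW (q / p) u)) := by
    refine ((lorW_meas q).comp measurable_fst).mul (Measurable.mul (Measurable.ite
      (measurableSet_lt (by fun_prop) (hS.comp measurable_snd)) measurable_const measurable_const)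
      ((lorW_meas _).comp measurable_snd))
  rw [e1, e2, lintegral_const_mul' _ _ ENNReal.ofReal_ne_top,
    lintegral_const_mul' _ _ ENNReal.ofReal_ne_top, ← mul_assoc, ← ENNReal.ofReal_mul hp.le,
    mul_div_cancel₀ _ hp.ne', lintegral_lintegral_swap hm.aemeasurable]

/-- the scale-invariant `L^q(dt/t)` functional -/
noncomputable def lorN (q : ℝ≥0∞) (w : ℝ → ℝ≥0∞) : ℝ≥0∞ :=
  if q = ∞ then ⨆ t ∈ Ioi (0 : ℝ), w t
  else (∫⁻ t in Ioi (0 : ℝ), w t ^ q.toReal / ENNReal.ofReal t) ^ (1 / q.toReal)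

theorem lorN_mono (q : ℝ≥0∞) (v w : ℝ → ℝ≥0∞) (h : ∀ t, 0 < t → v t ≤ w t) :
    lorN q v ≤ lorN q w := by
  unfold lorN
  split_ifs
  · exact iSup₂_mono h
  · refine ENNReal.rpow_le_rpow (setLIntegral_mono' measurableSet_Ioi fun t ht => ?_)
      (by positivity)
    exact ENNReal.div_le_div_right (ENNReal.rpow_le_rpow (h t ht) (by positivity)) _

theorem lorN_const (q : ℝ≥0∞) (hq : 1 ≤ q) (c : ℝ≥0∞) (hc : c ≠ ∞) (w : ℝ → ℝ≥0∞) :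
    lorN q (fun t => c * w t) = c * lorN q w := by
  unfold lorN
  split_ifs with h
  · simp only [ENNReal.mul_iSup]
  · have hq0 : 0 < q.toReal := ENNReal.toReal_pos (by positivity) h
    simp only [ENNReal.mul_rpow_of_nonneg _ _ hq0.le, mul_div_assoc]
    rw [lintegral_const_mul' _ _ (ENNReal.rpow_ne_top_of_nonneg hq0.le hc),
      ENNReal.mul_rpow_of_nonneg _ _ (by positivity), ← ENNReal.rpow_mul, mul_one_div_cancel hq0.ne',
      ENNReal.rpow_one]

theorem lorN_scale (q : ℝ≥0∞) (w : ℝ → ℝ≥0∞) :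
    lorN q w ≤ lorN q (fun t => w (2 * t)) := by
  unfold lorN
  split_ifs with h
  · refine iSup₂_le fun t ht => ?_
    have ht : 0 < t := ht
    refine le_trans (le_of_eq ?_) (le_iSup₂ (t / 2) (show t / 2 ∈ Ioi (0 : ℝ) by simpa using ht))
    congr 1; ring
  · have := lintegral_image_eq_lintegral_abs_deriv_mul (f := fun x : ℝ => 2 * x)
      (f' := fun _ => 2) (s := Ioi (0 : ℝ)) measurableSet_Ioi
      (fun x _ => by simpa using ((hasDerivAt_id x).const_mul 2).hasDerivWithinAt)
      (fun x _ y _ h => by simpa using h)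
      (fun t => w t ^ q.toReal / ENNReal.ofReal t)
    have hi : (fun x : ℝ => 2 * x) '' Ioi 0 = Ioi 0 := by
      rw [image_const_mul_Ioi_zero (by norm_num)]
    rw [hi] at this
    rw [this]
    refine le_of_eq ?_
    congr 1
    refine setLIntegral_congr_fun measurableSet_Ioi fun t ht => ?_
    simp only
    rw [abs_two, ENNReal.ofReal_mul (by norm_num), div_eq_mul_inv, div_eq_mul_inv,
      ENNReal.mul_inv (by simp) (by simp), mul_left_comm, ← mul_assoc (ENNReal.ofReal 2),
      ENNReal.mul_inv_cancel (by simp) (by simp), one_mul]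

theorem lorN_int (r : ℝ) (w : ℝ → ℝ≥0∞) (hw : Measurable w) :
    ∫⁻ t in Ioi (0 : ℝ), w t ^ r / ENNReal.ofReal t =
    ∫⁻ t, w t ^ r ∂((volume.restrict (Ioi (0 : ℝ))).withDensity fun t => (ENNReal.ofReal t)⁻¹) := by
  rw [lintegral_withDensity_eq_lintegral_mul _ (by fun_prop) (by fun_prop)]
  simp only [Pi.mul_apply, div_eq_mul_inv, mul_comm]

theorem lorN_bdd (q : ℝ≥0∞) (hq : 1 ≤ q) (v w : ℝ → ℝ≥0∞) (hw : Measurable w) :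
    lorN q (fun t => v t * w t) ≤ lorN ∞ v * lorN q w := by
  have h1 : ∀ t, 0 < t → v t ≤ lorN ∞ v := fun t ht => by
    simp only [lorN, if_true]
    exact le_iSup₂ (f := fun t (_ : t ∈ Ioi (0 : ℝ)) => v t) t ht
  refine (lorN_mono q _ (fun t => lorN ∞ v * w t) fun t ht => by gcongr; exact h1 t ht).trans ?_
  by_cases hv : lorN ∞ v = ∞
  · rw [hv]
    unfold lorN
    split_ifs with h
    · simp only [ENNReal.mul_iSup, le_refl]
    · have hq0 : 0 < q.toReal := ENNReal.toReal_pos (by positivity) h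
      simp only [ENNReal.mul_rpow_of_nonneg _ _ hq0.le, mul_div_assoc]
      rw [lintegral_const_mul _ (by fun_prop),
        ENNReal.mul_rpow_of_nonneg _ _ (by positivity), ← ENNReal.rpow_mul,
        mul_one_div_cancel hq0.ne', ENNReal.rpow_one]
  · exact (lorN_const q hq _ hv w).le

theorem lorN_holder (q q₁ q₂ : ℝ≥0∞) (hq : 1 ≤ q) (hq₁ : 1 ≤ q₁) (hq₂ : 1 ≤ q₂)
    (hqeq : 1 / q = 1 / q₁ + 1 / q₂) (v w : ℝ → ℝ≥0∞) (hv : Measurable v) (hw : Measurable w) :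
    lorN q (fun t => v t * w t) ≤ lorN q₁ v * lorN q₂ w := by
  by_cases h1 : q₁ = ∞
  · have : q = q₂ := by simpa [h1] using hqeq
    subst this; subst h1
    exact lorN_bdd q hq v w hw
  by_cases h2 : q₂ = ∞
  · have : q = q₁ := by simpa [h2] using hqeq
    subst this; subst h2
    simp only [mul_comm (v _)]
    rw [mul_comm]
    exact lorN_bdd q hq w v hv
  have h : q ≠ ∞ := by
    rintro rfl
    have h3 : q₁⁻¹ + q₂⁻¹ = 0 := by simpa using hqeq.symm
    rw [add_eq_zero] at h3
    exact h1 (ENNReal.inv_eq_zero.1 h3.1)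
  have hq0 : 0 < q.toReal := ENNReal.toReal_pos (by positivity) h
  have hq10 : 0 < q₁.toReal := ENNReal.toReal_pos (by positivity) h1
  have hq20 : 0 < q₂.toReal := ENNReal.toReal_pos (by positivity) h2
  have hr : 1 / q.toReal = 1 / q₁.toReal + 1 / q₂.toReal := by
    have := congrArg ENNReal.toReal hqeq
    rw [ENNReal.toReal_add (by simp; positivity) (by simp; positivity)] at this
    simpa using this
  have hlt : q.toReal < q₁.toReal := by
    rw [← one_div_lt_one_div hq10 hq0, hr]
    have : 0 < 1 / q₂.toReal := by positivity
    linarith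
  simp only [lorN, h, h1, h2, if_false]
  rw [lorN_int _ _ hv, lorN_int _ _ hw, lorN_int _ (fun t => v t * w t) (hv.mul hw)]
  exact ENNReal.lintegral_Lp_mul_le_Lq_mul_Lr hq0 hlt hr _ hv.aemeasurable hw.aemeasurable

section star
variable {n : ℕ}

/-- decreasing rearrangement -/
noncomputable def lorStar (f : EuclideanSpace ℝ (Fin n) → ℂ) (u : ℝ) : ℝ≥0∞ :=
  sInf {s : ℝ≥0∞ | volume {x | s < ‖f x‖ₑ} ≤ ENNReal.ofReal u}

theorem lorStar_anti (f : EuclideanSpace ℝ (Fin n) → ℂ) : Antitone (lorStar f) := by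
  intro u v huv
  exact sInf_le_sInf fun s hs => le_trans hs (ENNReal.ofReal_le_ofReal huv)

theorem lorStar_spec (f : EuclideanSpace ℝ (Fin n) → ℂ) (u : ℝ) :
    volume {x | lorStar f u < ‖f x‖ₑ} ≤ ENNReal.ofReal u := by
  obtain ⟨s, hs, hlim, hmem⟩ := exists_seq_tendsto_sInf
    (S := {s : ℝ≥0∞ | volume {x | s < ‖f x‖ₑ} ≤ ENNReal.ofReal u}) ⟨∞, by simp⟩ (OrderBot.bddBelow _)
  have hsub : {x | lorStar f u < ‖f x‖ₑ} ⊆ ⋃ k, {x | s k < ‖f x‖ₑ} := by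
    intro x hx
    obtain ⟨k, hk⟩ := (hlim.eventually (gt_mem_nhds hx)).exists
    exact mem_iUnion.2 ⟨k, hk⟩
  refine (measure_mono hsub).trans ?_
  rw [Monotone.measure_iUnion]
  · exact iSup_le hmem
  · intro i j hij x hx
    exact lt_of_le_of_lt (hs hij) hx

theorem lorStar_lt_iff (f : EuclideanSpace ℝ (Fin n) → ℂ) (t u : ℝ) (ht : 0 < t) :
    ENNReal.ofReal u < volume {x | t < ‖f x‖} ↔ ENNReal.ofReal t < lorStar f u := by
  have : {x | t < ‖f x‖} = {x | ENNReal.ofReal t < ‖f x‖ₑ} := by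
    ext x
    simp only [mem_ofPred_eq]
    rw [← ofReal_norm, ENNReal.ofReal_lt_ofReal_iff_of_nonneg ht.le]
  rw [this, ← not_le, ← not_le, not_iff_not]
  constructor
  · intro h
    exact sInf_le h
  · intro h
    exact (measure_mono fun x hx => lt_of_le_of_lt h hx).trans (lorStar_spec f u)

theorem lorStar_mul (f g : EuclideanSpace ℝ (Fin n) → ℂ) (u : ℝ) (hu : 0 < u) :
    lorStar (fun x => f x * g x) (2 * u) ≤ lorStar f u * lorStar g u := by
  refine sInf_le ?_
  have hsub : {x | lorStar f u * lorStar g u < ‖f x * g x‖ₑ} ⊆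
      {x | lorStar f u < ‖f x‖ₑ} ∪ {x | lorStar g u < ‖g x‖ₑ} := by
    intro x hx
    by_contra hcon
    simp only [mem_union, mem_ofPred_eq, not_or, not_lt] at hcon hx
    rw [enorm_mul] at hx
    exact absurd hx (not_lt.2 (mul_le_mul' hcon.1 hcon.2))
  refine (measure_mono hsub).trans ((measure_union_le _ _).trans ?_)
  rw [two_mul, ENNReal.ofReal_add hu.le hu.le]
  exact add_le_add (lorStar_spec f u) (lorStar_spec g u)

/-- weighted rearrangement -/
noncomputable def lorG (p : ℝ) (f : EuclideanSpace ℝ (Fin n) → ℂ) (u : ℝ) : ℝ≥0∞ :=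
  ENNReal.ofReal u ^ (1 / p) * lorStar f u

theorem lorG_meas (p : ℝ) (f : EuclideanSpace ℝ (Fin n) → ℂ) : Measurable (lorG p f) := by
  have := (lorStar_anti f).measurable
  unfold lorG
  fun_prop

theorem lor_iSup_lt (X Y : ℝ≥0∞) (h : ∀ c : ℝ, 0 < c → ENNReal.ofReal c < X →
    ENNReal.ofReal c ≤ Y) : X ≤ Y := by
  refine le_of_forall_lt_imp_le_of_dense fun a ha => ?_
  rcases eq_or_ne a 0 with rfl | h0
  · simp
  · have := h a.toReal (ENNReal.toReal_pos h0 ha.ne_top)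
    rw [ENNReal.ofReal_toReal ha.ne_top] at this
    exact this ha

theorem lor_mul_le (a b : ℝ) (ha : 0 < a) (hb : 0 < b) (X Y K : ℝ≥0∞)
    (h : ∀ c : ℝ, 0 < c → ENNReal.ofReal c < X →
      ENNReal.ofReal a ^ b * ENNReal.ofReal c ≤ K) : ENNReal.ofReal a ^ b * X ≤ K := by
  have h0 : ENNReal.ofReal a ^ b ≠ 0 := by simp [ha, hb.le]
  have ht : ENNReal.ofReal a ^ b ≠ ∞ := ENNReal.rpow_ne_top_of_nonneg hb.le (by simp)
  rw [mul_comm, ← ENNReal.le_div_iff_mul_le (Or.inl h0) (Or.inl ht)]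
  refine lor_iSup_lt _ _ fun c hc hcX => ?_
  rw [ENNReal.le_div_iff_mul_le (Or.inl h0) (Or.inl ht), mul_comm]
  exact h c hc hcX

theorem lor_top_eq (p : ℝ) (hp : 1 ≤ p) (f : EuclideanSpace ℝ (Fin n) → ℂ) :
    lorentzNorm n p ∞ f = lorN ∞ (lorG p f) := by
  have hp' : 0 < 1 / p := by positivity
  simp only [lorentzNorm, lorN, if_true]
  apply le_antisymm
  · refine iSup₂_le fun t ht => ?_
    have ht : 0 < t := ht
    set K := ⨆ u ∈ Ioi (0 : ℝ), lorG p f u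
    have key : ∀ c : ℝ, 0 < c → ENNReal.ofReal c < volume {x | t < ‖f x‖} →
        ENNReal.ofReal t * ENNReal.ofReal c ^ (1 / p) ≤ K := by
      intro c hc hcX
      rw [lorStar_lt_iff f t c ht] at hcX
      rw [mul_comm]
      exact le_trans (mul_le_mul' le_rfl hcX.le)
        (le_iSup₂ (f := fun u (_ : u ∈ Ioi (0 : ℝ)) => lorG p f u) c hc)
    have h0 : ENNReal.ofReal t ≠ 0 := by simp [ht]
    rw [mul_comm, ← ENNReal.le_div_iff_mul_le (Or.inl h0) (Or.inl (by simp))]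
    rw [one_div, ENNReal.rpow_inv_le_iff (by positivity)]
    refine lor_iSup_lt _ _ fun c hc hcX => ?_
    rw [← ENNReal.rpow_inv_le_iff (by positivity), ENNReal.le_div_iff_mul_le (Or.inl h0)
      (Or.inl (by simp)), mul_comm, ← one_div]
    exact key c hc hcX
  · refine iSup₂_le fun u hu => ?_
    have hu : 0 < u := hu
    refine lor_mul_le u (1 / p) hu hp' _ 0 _ fun c hc hcX => ?_
    rw [← lorStar_lt_iff f c u hc] at hcX
    rw [mul_comm]
    exact le_trans (mul_le_mul' le_rfl (ENNReal.rpow_le_rpow hcX.le hp'.le))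
      (le_iSup₂ (f := fun t (_ : t ∈ Ioi (0 : ℝ)) =>
        ENNReal.ofReal t * (volume {x | t < ‖f x‖}) ^ (1 / p)) c hc)

theorem lor_fin_eq (p : ℝ) (hp : 1 ≤ p) (q : ℝ≥0∞) (hq : 1 ≤ q) (h : q ≠ ∞)
    (f : EuclideanSpace ℝ (Fin n) → ℂ) :
    ENNReal.ofReal p ^ (1 / q.toReal) * lorentzNorm n p q f = lorN q (lorG p f) := by
  have hq0 : 0 < q.toReal := ENNReal.toReal_pos (by positivity) h
  simp only [lorentzNorm, lorN, h, if_false]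
  rw [← ENNReal.mul_rpow_of_nonneg _ _ (by positivity), lor_fubini p q.toReal (by positivity) hq0 _
    (lorStar f) (lorStar_anti f).measurable (fun t u ht _ => lorStar_lt_iff f t u ht)]
  rfl

theorem lor_le (p : ℝ) (hp : 1 ≤ p) (q : ℝ≥0∞) (hq : 1 ≤ q)
    (f : EuclideanSpace ℝ (Fin n) → ℂ) : lorentzNorm n p q f ≤ lorN q (lorG p f) := by
  by_cases h : q = ∞
  · subst h; exact (lor_top_eq p hp f).le
  · rw [← lor_fin_eq p hp q hq h]
    refine le_mul_of_one_le_left' ?_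
    rw [← ENNReal.one_rpow (1 / q.toReal)]
    exact ENNReal.rpow_le_rpow (by simpa using hp) (by positivity)

theorem lor_ge (p : ℝ) (hp : 1 ≤ p) (q : ℝ≥0∞) (hq : 1 ≤ q)
    (f : EuclideanSpace ℝ (Fin n) → ℂ) :
    lorN q (lorG p f) ≤ ENNReal.ofReal p * lorentzNorm n p q f := by
  have hp1 : 1 ≤ ENNReal.ofReal p := by simpa using hp
  by_cases h : q = ∞
  · subst h; rw [lor_top_eq p hp f]
    exact le_mul_of_one_le_left' hp1
  · rw [← lor_fin_eq p hp q hq h]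
    have h1 : 1 ≤ q.toReal := by
      rw [← ENNReal.toReal_one]; exact ENNReal.toReal_mono h hq
    gcongr
    refine (ENNReal.rpow_le_rpow_of_exponent_le hp1 (y := 1 / q.toReal) (z := 1) ?_).trans (by simp)
    rw [div_le_one (by positivity)]; exact h1

end star

/-- **Hölder's inequality in Lorentz spaces**: if `1 ≤ p, p₁, p₂ < ∞` and
`1 ≤ q, q₁, q₂ ≤ ∞` with `1/p = 1/p₁ + 1/p₂` and `1/q = 1/q₁ + 1/q₂`, then there
is a constant `C` with `‖fg‖_{L^{p,q}} ≤ C ‖f‖_{L^{p₁,q₁}} ‖g‖_{L^{p₂,q₂}}` for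
all measurable `f, g`. -/
theorem lorentz_holder (n : ℕ) (p p₁ p₂ : ℝ) (q q₁ q₂ : ℝ≥0∞)
    (hp : 1 ≤ p) (hp₁ : 1 ≤ p₁) (hp₂ : 1 ≤ p₂)
    (hq : 1 ≤ q) (hq₁ : 1 ≤ q₁) (hq₂ : 1 ≤ q₂)
    (hpeq : 1 / p = 1 / p₁ + 1 / p₂) (hqeq : 1 / q = 1 / q₁ + 1 / q₂) :
    ∃ C : ℝ≥0, 0 < C ∧
      ∀ f g : EuclideanSpace ℝ (Fin n) → ℂ, Measurable f → Measurable g →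
        lorentzNorm n p q (fun x => f x * g x) ≤
          C * lorentzNorm n p₁ q₁ f * lorentzNorm n p₂ q₂ g := by
  have hp0 : 0 < p := by linarith
  have hp10 : 0 < p₁ := by linarith
  have hp20 : 0 < p₂ := by linarith
  refine ⟨2 ^ (1 / p) * p₁.toNNReal * p₂.toNNReal, ?_, fun f g _ _ => ?_⟩
  · have : 0 < p₁.toNNReal := by simpa using hp10
    have : 0 < p₂.toNNReal := by simpa using hp20
    positivity
  have hc : ((2 : ℝ≥0∞) ^ (1 / p)) ≠ ∞ := ENNReal.rpow_ne_top_of_nonneg (by positivity) (by simp)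
  calc lorentzNorm n p q (fun x => f x * g x)
      ≤ lorN q (lorG p (fun x => f x * g x)) := lor_le p hp q hq _
    _ ≤ lorN q (fun t => lorG p (fun x => f x * g x) (2 * t)) := lorN_scale q _
    _ ≤ lorN q (fun t => (2 : ℝ≥0∞) ^ (1 / p) * (lorG p₁ f t * lorG p₂ g t)) := by
        refine lorN_mono q _ _ fun t ht => ?_
        unfold lorG
        refine (mul_le_mul' le_rfl (lorStar_mul f g t ht)).trans (le_of_eq ?_)
        have ht' : ENNReal.ofReal t ≠ 0 := by simp [ht]
        rw [ENNReal.ofReal_mul (by norm_num), ENNReal.mul_rpow_of_nonneg _ _ (by positivity)]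
        nth_rewrite 2 [hpeq]
        rw [ENNReal.rpow_add _ _ ht' (by simp), ENNReal.ofReal_ofNat]
        ring
    _ = (2 : ℝ≥0∞) ^ (1 / p) * lorN q (fun t => lorG p₁ f t * lorG p₂ g t) :=
        lorN_const q hq _ hc _
    _ ≤ (2 : ℝ≥0∞) ^ (1 / p) * (lorN q₁ (lorG p₁ f) * lorN q₂ (lorG p₂ g)) := by
        gcongr
        exact lorN_holder q q₁ q₂ hq hq₁ hq₂ hqeq _ _ (lorG_meas _ _) (lorG_meas _ _)
    _ ≤ (2 : ℝ≥0∞) ^ (1 / p) * ((ENNReal.ofReal p₁ * lorentzNorm n p₁ q₁ f) *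
          (ENNReal.ofReal p₂ * lorentzNorm n p₂ q₂ g)) := by
        gcongr
        · exact lor_ge p₁ hp₁ q₁ hq₁ f
        · exact lor_ge p₂ hp₂ q₂ hq₂ g
    _ = _ := by
        have h2 : ((2 ^ (1 / p) : ℝ≥0) : ℝ≥0∞) = (2 : ℝ≥0∞) ^ (1 / p) := by
          rw [ENNReal.coe_rpow_of_nonneg _ (by positivity)]; simp
        push_cast
        rw [h2]
        simp only [ENNReal.ofReal]
        ring
end

section
/- Let n ≥ 3, ν > 0, and let V : ℝ^n → ℝ be measurable with |x|^2 V(x) ≥ −n^2/4 + ν for a.e. x. Then for all f ∈ C_0^∞(ℝ^n) with P f = 0 (f orthogonal to radial functions, i.e., f = P^⊥ f), one has ∫ (|∇f|^2 + V|f|^2) dx ≥ ν ∫ |x|^{-2} |f|^2 dx. -/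
open MeasureTheory

open ProbabilityTheory Set Filter Topology NNReal in
lemma lbn_half (v : ℝ≥0) (hv : v ≠ 0) (u : ℝ → ℂ) (hu : Differentiable ℝ u) (B C : ℝ)
    (hb : ∀ x, ‖u x‖ ≤ B) (hd : ∀ x, ‖deriv u x‖ ≤ C) :
    ∫ x in Ioi (0:ℝ), gaussianPDFReal 0 v x * ‖u x - u 0‖ ^ 2 ≤
      v * ∫ x in Ioi (0:ℝ), gaussianPDFReal 0 v x * ‖deriv u x‖ ^ 2 := by
  set w := gaussianPDFReal 0 v with hw
  have hv0 : (0:ℝ) < v := by positivity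
  have hC : 0 ≤ C := (norm_nonneg _).trans (hd 0)
  have hB : 0 ≤ B := (norm_nonneg _).trans (hb 0)
  have w0 : ∀ x, 0 ≤ w x := gaussianPDFReal_nonneg 0 v
  have wint : Integrable w := integrable_gaussianPDFReal 0 v
  have wmeas : Measurable w := measurable_gaussianPDFReal 0 v
  have hwx : ∀ x, w x = (√(2 * Real.pi * v))⁻¹ * Real.exp (-(x - 0) ^ 2 / (2 * v)) := fun x => by
    rw [hw, gaussianPDFReal_def]
  have wder : ∀ x, HasDerivAt w (-(x / v) * w x) x := by
    intro x
    have h : HasDerivAt (fun x : ℝ => (√(2 * Real.pi * v))⁻¹ * Real.exp (-(x - 0) ^ 2 / (2 * v)))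
      ((√(2 * Real.pi * v))⁻¹ * (Real.exp (-(x - 0) ^ 2 / (2 * v)) * (-(2 * (x - 0)) / (2 * v)))) x := by
      have h1 : HasDerivAt (fun x : ℝ => -(x - 0) ^ 2 / (2 * v)) (-(2 * (x - 0)) / (2 * v)) x := by
        have := (((hasDerivAt_id x).sub_const 0).pow 2).neg.div_const (2 * (v:ℝ))
        refine HasDerivAt.congr_deriv this ?_
        norm_num
      exact (h1.exp).const_mul _
    rw [show w = _ from funext hwx]
    refine h.congr_deriv ?_
    ring
  have qlip : ∀ x, ‖u x - u 0‖ ≤ C * |x| := by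
    intro x
    have := Convex.norm_image_sub_le_of_norm_deriv_le (f := u) (s := univ) (x := 0) (y := x)
      (fun z _ => hu z) (fun z _ => hd z) convex_univ (mem_univ _) (mem_univ _)
    simpa using this
  have qbd : ∀ x, ‖u x - u 0‖ ≤ 2 * B := by
    intro x
    calc _ ≤ ‖u x‖ + ‖u 0‖ := norm_sub_le _ _
      _ ≤ _ := by linarith [hb x, hb 0]
  have dmeas : Measurable (deriv u) := measurable_deriv u
  have umeas : Measurable u := hu.continuous.measurable
  have int1 : Integrable (fun x => w x * ‖u x - u 0‖ ^ 2) := by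
    refine (wint.mul_const ((2 * B)^2)).mono' (by fun_prop) (.of_forall fun x => ?_)
    rw [Real.norm_of_nonneg (mul_nonneg (w0 x) (by positivity))]
    gcongr
    · exact w0 x
    · exact qbd x
  have int2 : Integrable (fun x => w x * ‖deriv u x‖ ^ 2) := by
    refine (wint.mul_const (C^2)).mono' (by fun_prop) (.of_forall fun x => ?_)
    rw [Real.norm_of_nonneg (mul_nonneg (w0 x) (by positivity))]
    gcongr
    · exact w0 x
    · exact hd x
  let F : ℝ → ℝ := fun x => ‖u x - u 0‖ ^ 2 * (x⁻¹ * w x)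
  let F' : ℝ → ℝ := fun x => (2 * inner ℝ (u x - u 0) (deriv u x)) * (x⁻¹ * w x) +
    ‖u x - u 0‖ ^ 2 * (-(x^2)⁻¹ * w x + x⁻¹ * (-(x / v) * w x))
  have hF : ∀ x ∈ Ioi (0:ℝ), HasDerivAt F (F' x) x := by
    intro x hx
    have h1 : HasDerivAt (fun x => u x - u 0) (deriv u x) x := (hu x).hasDerivAt.sub_const _
    have h2 := h1.norm_sq
    exact h2.mul ((hasDerivAt_inv (ne_of_gt hx)).mul (wder x))
  have Fb : ∀ x, |F x| ≤ C ^ 2 * |x| * w x := by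
    intro x
    rcases eq_or_ne x 0 with rfl | hx
    · simp [F]
    · have : |F x| = ‖u x - u 0‖ ^ 2 * (|x|⁻¹ * w x) := by
        simp [F, abs_mul, abs_of_nonneg (w0 x)]
      rw [this]
      calc _ ≤ (C * |x|)^2 * (|x|⁻¹ * w x) := by
            gcongr
            · exact mul_nonneg (by positivity) (w0 x)
            · exact qlip x
        _ = _ := by have := abs_pos.2 hx; field_simp
  have wc : Continuous w := continuous_iff_continuousAt.2 fun x => (wder x).continuousAt
  have hcont : ContinuousWithinAt F (Ici 0) 0 := by
    apply ContinuousAt.continuousWithinAt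
    have h0 : F 0 = 0 := by simp [F]
    rw [ContinuousAt, h0]
    have : Tendsto (fun x : ℝ => C ^ 2 * |x| * w x) (𝓝 0) (𝓝 0) := by
      have : Continuous (fun x : ℝ => C ^ 2 * |x| * w x) := by fun_prop
      simpa using this.tendsto 0
    exact squeeze_zero_norm Fb this
  have F'int : IntegrableOn F' (Ioi 0) := by
    refine ((wint.mul_const (3 * C^2 + (2*B)^2 / v)).integrableOn (s := Ioi 0)).mono'
      (by fun_prop) ?_
    refine (ae_restrict_iff' measurableSet_Ioi).2 (.of_forall fun x hx => ?_)
    have hx : 0 < x := hx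
    have a1 : |2 * inner ℝ (u x - u 0) (deriv u x) * (x⁻¹ * w x)| ≤ 2 * C^2 * w x := by
      rw [abs_mul, abs_mul, abs_of_nonneg (mul_nonneg (inv_nonneg.2 hx.le) (w0 x)), abs_two]
      calc _ ≤ 2 * ((C * |x|) * C) * (x⁻¹ * w x) := by
            gcongr
            · exact mul_nonneg (by positivity) (w0 x)
            · exact (abs_real_inner_le_norm _ _).trans (by gcongr; exact qlip x; exact hd x)
        _ = _ := by rw [abs_of_pos hx]; field_simp
    have a2 : |‖u x - u 0‖ ^ 2 * (-(x^2)⁻¹ * w x)| ≤ C^2 * w x := by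
      rw [abs_mul, abs_mul, abs_neg, abs_of_nonneg (w0 x), abs_of_nonneg (by positivity), abs_of_nonneg (by positivity)]
      calc _ ≤ (C * |x|)^2 * ((x^2)⁻¹ * w x) := by
            gcongr
            · exact mul_nonneg (by positivity) (w0 x)
            · exact qlip x
        _ = _ := by rw [abs_of_pos hx]; field_simp
    have a3 : |‖u x - u 0‖ ^ 2 * (x⁻¹ * (-(x / v) * w x))| ≤ (2*B)^2 / v * w x := by
      have : ‖u x - u 0‖ ^ 2 * (x⁻¹ * (-(x / v) * w x)) = - (‖u x - u 0‖ ^ 2 / v * w x) := by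
        field_simp
      rw [this, abs_neg, abs_of_nonneg (mul_nonneg (by positivity) (w0 x))]
      gcongr
      · exact w0 x
      · exact qbd x
    have : F' x = 2 * inner ℝ (u x - u 0) (deriv u x) * (x⁻¹ * w x) + ‖u x - u 0‖ ^ 2 * (-(x^2)⁻¹ * w x)
      + ‖u x - u 0‖ ^ 2 * (x⁻¹ * (-(x / v) * w x)) := by simp only [F']; ring
    rw [this, Real.norm_eq_abs]
    refine (abs_add_three _ _ _).trans ?_
    linarith
  have hlim : Tendsto F atTop (𝓝 0) := by
    have hK : Tendsto (fun x : ℝ => (2*B)^2 * (√(2 * Real.pi * v))⁻¹ * x⁻¹) atTop (𝓝 0) := by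
      have := (tendsto_inv_atTop_zero (𝕜 := ℝ)).const_mul ((2*B)^2 * (√(2 * Real.pi * v))⁻¹)
      rwa [mul_zero] at this
    refine squeeze_zero_norm' ?_ hK
    filter_upwards [eventually_gt_atTop 0] with x hx
    have hwb : w x ≤ (√(2 * Real.pi * v))⁻¹ := by
      rw [hwx]
      have : Real.exp (-(x - 0) ^ 2 / (2 * v)) ≤ 1 := by
        rw [Real.exp_le_one_iff]
        exact div_nonpos_of_nonpos_of_nonneg (by nlinarith [sq_nonneg (x-0)]) (by positivity)
      calc _ ≤ (√(2 * Real.pi * v))⁻¹ * 1 := by gcongr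
        _ = _ := mul_one _
    simp only [F]
    rw [Real.norm_of_nonneg (mul_nonneg (by positivity) (mul_nonneg (by positivity) (w0 x)))]
    calc _ ≤ (2*B)^2 * (x⁻¹ * (√(2 * Real.pi * v))⁻¹) := by
          gcongr
          · exact mul_nonneg (by positivity) (w0 x)
          · exact qbd x
      _ = _ := by ring
  have hI := integral_Ioi_of_hasDerivAt_of_tendsto hcont hF F'int hlim
  have h0 : F 0 = 0 := by simp [F]
  rw [h0, sub_zero] at hI
  have key : ∫ x in Ioi (0:ℝ), (w x * ‖u x - u 0‖ ^ 2 + v * F' x) ≤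
      ∫ x in Ioi (0:ℝ), v * (w x * ‖deriv u x‖ ^ 2) := by
    refine setIntegral_mono_on ((int1.integrableOn).add (F'int.const_mul _)) (int2.integrableOn.const_mul _) measurableSet_Ioi fun x hx => ?_
    have hx : 0 < x := hx
    have e := norm_sub_sq_real (deriv u x) (x⁻¹ • (u x - u 0))
    rw [inner_smul_right, norm_smul, real_inner_comm] at e
    have e2 : v * (w x * ‖deriv u x‖ ^ 2) - (w x * ‖u x - u 0‖ ^ 2 + v * F' x) =
      v * (w x * ‖deriv u x - x⁻¹ • (u x - u 0)‖^2) := by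
      rw [e, Real.norm_of_nonneg (by positivity)]
      simp only [F']
      field_simp
      ring
    have : 0 ≤ v * (w x * ‖deriv u x - x⁻¹ • (u x - u 0)‖^2) := 
      mul_nonneg hv0.le (mul_nonneg (w0 x) (by positivity))
    linarith
  rw [integral_add int1.integrableOn (F'int.const_mul _), integral_const_mul, integral_const_mul, hI] at key
  linarith

open ProbabilityTheory Set Filter Topology NNReal in
lemma lbn_oneD (v : ℝ≥0) (hv : v ≠ 0) (u : ℝ → ℂ) (hu : Differentiable ℝ u) (B C : ℝ)
    (hb : ∀ x, ‖u x‖ ≤ B) (hd : ∀ x, ‖deriv u x‖ ≤ C) :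
    ∫ x, ‖u x‖ ^ 2 ∂(gaussianReal 0 v) ≤ ‖∫ x, u x ∂(gaussianReal 0 v)‖ ^ 2 + 
      v * ∫ x, ‖deriv u x‖ ^ 2 ∂(gaussianReal 0 v) := by
  have dmeas : Measurable (deriv u) := measurable_deriv u
  have umeas : Measurable u := hu.continuous.measurable
  have ib : ∀ {E : Type} [NormedAddCommGroup E] (h : ℝ → E), AEStronglyMeasurable h (gaussianReal 0 v) → ∀ K : ℝ, (∀ x, ‖h x‖ ≤ K) → Integrable h (gaussianReal 0 v) :=
    fun h hm K hK => (integrable_const K).mono' hm (.of_forall hK)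
  have iu : Integrable u (gaussianReal 0 v) := ib u umeas.aestronglyMeasurable B hb
  have iu2 : Integrable (fun x => ‖u x‖^2) (gaussianReal 0 v) := 
    ib _ (by fun_prop) (B^2) fun x => by
      rw [Real.norm_of_nonneg (by positivity)]; gcongr; exact hb x
  have iq2 : Integrable (fun x => ‖u x - u 0‖^2) (gaussianReal 0 v) := 
    ib _ (by fun_prop) ((2*B)^2) fun x => by
      rw [Real.norm_of_nonneg (by positivity)]; gcongr; 
      exact (norm_sub_le _ _).trans (by linarith [hb x, hb 0])
  have id2 : Integrable (fun x => ‖deriv u x‖^2) (gaussianReal 0 v) := 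
    ib _ (by fun_prop) (C^2) fun x => by
      rw [Real.norm_of_nonneg (by positivity)]; gcongr; exact hd x
  have conv : ∀ h : ℝ → ℝ, Integrable h (gaussianReal 0 v) → Integrable (fun x => gaussianPDFReal 0 v x * h x) := by
    intro h hh
    rw [gaussianReal_of_var_ne_zero _ hv, integrable_withDensity_iff_integrable_smul'] at hh
    · refine hh.congr (.of_forall fun x => ?_)
      simp [toReal_gaussianPDF]
    · exact measurable_gaussianPDF _ _
    · exact .of_forall fun x => gaussianPDF_lt_top
  have main : ∫ x, ‖u x - u 0‖^2 ∂(gaussianReal 0 v) ≤ v * ∫ x, ‖deriv u x‖ ^ 2 ∂(gaussianReal 0 v) := by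
    rw [integral_gaussianReal_eq_integral_smul hv, integral_gaussianReal_eq_integral_smul hv]
    simp only [smul_eq_mul]
    have c1 := conv _ iq2
    have c2 := conv _ id2
    rw [← intervalIntegral.integral_Iic_add_Ioi c1.integrableOn c1.integrableOn (b := 0),
      ← intervalIntegral.integral_Iic_add_Ioi c2.integrableOn c2.integrableOn (b := 0)]
    have h1 := lbn_half v hv u hu B C hb hd
    have hdn : ∀ x, deriv (fun x => u (-x)) x = - deriv u (-x) := fun x => deriv_comp_neg u x
    have h2 := lbn_half v hv (fun x => u (-x)) (hu.comp differentiable_neg) B C (fun x => hb _) (fun x => by rw [hdn, norm_neg]; exact hd _)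
    simp only [hdn, norm_neg, neg_zero] at h2
    have hpdf : ∀ x, gaussianPDFReal 0 v x = gaussianPDFReal 0 v (-x) := by
      intro x; simp [gaussianPDFReal_def]
    have e1 := integral_comp_neg_Ioi (0:ℝ) (fun x => gaussianPDFReal 0 v x * ‖u x - u 0‖ ^ 2)
    have e2 := integral_comp_neg_Ioi (0:ℝ) (fun x => gaussianPDFReal 0 v x * ‖deriv u x‖ ^ 2)
    simp only [← hpdf, neg_zero] at e1 e2
    rw [e1, e2] at h2
    linarith
  have var : ∫ x, ‖u x - u 0‖^2 ∂(gaussianReal 0 v) = ∫ x, ‖u x‖^2 ∂(gaussianReal 0 v) 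
      - 2 * inner ℝ (u 0) (∫ x, u x ∂(gaussianReal 0 v)) + ‖u 0‖^2 := by
    have ii : Integrable (fun x => inner ℝ (u 0) (u x)) (gaussianReal 0 v) := iu.const_inner _
    rw [← integral_inner iu, ← integral_const_mul, ← integral_sub iu2 (ii.const_mul 2)]
    have : ‖u 0‖^2 = ∫ x, ‖u 0‖^2 ∂(gaussianReal 0 v) := by simp
    have i3 : Integrable (fun x => ‖u x‖^2 - 2 * inner ℝ (u 0) (u x)) (gaussianReal 0 v) :=
      iu2.sub (ii.const_mul 2)
    rw [this, ← integral_add i3 (integrable_const _)]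
    congr 1; ext x
    rw [norm_sub_sq_real, real_inner_comm]
  have := norm_sub_sq_real (u 0) (∫ x, u x ∂(gaussianReal 0 v))
  nlinarith [sq_nonneg ‖u 0 - ∫ x, u x ∂(gaussianReal 0 v)‖]

lemma lbn_jensen {α : Type*} [MeasurableSpace α] (μ : Measure α) [IsProbabilityMeasure μ] (h : α → ℂ)
    (hm : AEStronglyMeasurable h μ) (K : ℝ) (hK : ∀ x, ‖h x‖ ≤ K) :
    ‖∫ x, h x ∂μ‖ ^ 2 ≤ ∫ x, ‖h x‖ ^ 2 ∂μ := by
  have ih : Integrable h μ := (integrable_const K).mono' hm (.of_forall hK)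
  have ih2 : Integrable (fun x => ‖h x‖^2) μ := by
    refine (integrable_const (K^2)).mono' (hm.norm.pow 2) (.of_forall fun x => ?_)
    rw [Real.norm_of_nonneg (by positivity)]; gcongr; exact hK x
  set m := ∫ x, h x ∂μ
  have ii : Integrable (fun x => inner ℝ m (h x)) μ := ih.const_inner _
  have e : ∫ x, (‖h x‖^2 - 2 * inner ℝ m (h x)) ∂μ = ∫ x, ‖h x‖^2 ∂μ - 2 * ‖m‖^2 := by
    rw [integral_sub ih2 (ii.const_mul 2), integral_const_mul, integral_inner ih,
      real_inner_self_eq_norm_sq]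
  have le : ∫ x, (-‖m‖^2) ∂μ ≤ ∫ x, (‖h x‖^2 - 2 * inner ℝ m (h x)) ∂μ := by
    refine integral_mono (integrable_const _) (ih2.sub (ii.const_mul 2)) fun x => ?_
    have := norm_sub_sq_real (h x) m
    rw [real_inner_comm] at this
    simp only []
    nlinarith [sq_nonneg ‖h x - m‖]
  rw [e] at le
  simp at le
  linarith

lemma lbn_cons_add {n : ℕ} (t s : ℝ) (x : Fin n → ℝ) (i : Fin n) :
    (Fin.cons t (x + s • Pi.single i 1) : Fin (n+1) → ℝ) =
      (Fin.cons t x : Fin (n+1) → ℝ) + s • (Pi.single i.succ 1 : Fin (n+1) → ℝ) := by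
  ext j
  refine Fin.cases ?_ (fun k => ?_) j
  · simp
  · simp [Pi.single_apply]

lemma lbn_cons_add0 {n : ℕ} (t s : ℝ) (x : Fin n → ℝ) :
    (Fin.cons (t + s) x : Fin (n+1) → ℝ) =
      (Fin.cons t x : Fin (n+1) → ℝ) + s • (Pi.single 0 1 : Fin (n+1) → ℝ) := by
  ext j
  refine Fin.cases ?_ (fun k => ?_) j
  · simp
  · simp [Pi.single_apply]

lemma lbn_cons_contDiff {n : ℕ} :
    ContDiff ℝ 1 (fun p : ℝ × (Fin n → ℝ) => (Fin.cons p.1 p.2 : Fin (n+1) → ℝ)) := by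
  rw [contDiff_pi]
  intro j
  refine Fin.cases ?_ (fun k => ?_) j
  · simpa using contDiff_fst
  · simp only [Fin.cons_succ]
    exact (contDiff_apply ℝ ℝ k).comp contDiff_snd

open ProbabilityTheory Set Filter Topology NNReal in
lemma lbn_pi (v : ℝ≥0) (hv : v ≠ 0) (B C : ℝ) (n : ℕ) : ∀ g : (Fin n → ℝ) → ℂ, ContDiff ℝ 1 g →
    (∀ x, ‖g x‖ ≤ B) → (∀ x i, ‖fderiv ℝ g x (Pi.single i 1)‖ ≤ C) → 
    ∫ x, ‖g x‖ ^ 2 ∂(Measure.pi fun _ : Fin n => gaussianReal 0 v) ≤ 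
      ‖∫ x, g x ∂(Measure.pi fun _ : Fin n => gaussianReal 0 v)‖ ^ 2 + 
      v * ∑ i, ∫ x, ‖fderiv ℝ g x (Pi.single i 1)‖ ^ 2 ∂(Measure.pi fun _ : Fin n => gaussianReal 0 v) := by
  induction n with
  | zero =>
    intro g hg hB hC
    have : ∀ x, g x = g 0 := fun x => by rw [Subsingleton.elim x 0]
    simp [this]
  | succ n IH =>
    intro g hg hB hC
    set μ := gaussianReal 0 v
    set π := Measure.pi fun _ : Fin n => μ
    have hI : ∀ {E : Type} [NormedAddCommGroup E] [NormedSpace ℝ E] (h : (Fin (n+1) → ℝ) → E) (K : ℝ),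
        AEStronglyMeasurable (fun p : ℝ × (Fin n → ℝ) => h (Fin.cons p.1 p.2)) (μ.prod π) → 
        (∀ x, ‖h x‖ ≤ K) →
        Integrable (fun p : ℝ × (Fin n → ℝ) => h (Fin.cons p.1 p.2)) (μ.prod π) ∧ 
        ∫ x, h x ∂(Measure.pi fun _ : Fin (n+1) => μ) = 
        ∫ t, ∫ x, h (Fin.cons t x) ∂π ∂μ := by
      intro E _ _ h K hm hK
      have hint : Integrable (fun p : ℝ × (Fin n → ℝ) => h (Fin.cons p.1 p.2)) (μ.prod π) :=
        (integrable_const K).mono' hm (.of_forall fun p => hK _)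
      refine ⟨hint, ?_⟩
      have := (measurePreserving_piFinSuccAbove (fun _ : Fin (n+1) => μ) 0).symm.integral_comp' h
      rw [← this]
      have e : ∀ p : ℝ × (Fin n → ℝ), (MeasurableEquiv.piFinSuccAbove (fun _ => ℝ) 0).symm p = (Fin.cons p.1 p.2 : Fin (n+1) → ℝ) := by
        intro p
        simp [MeasurableEquiv.piFinSuccAbove]
        rfl
      simp only [e]
      exact integral_prod _ hint
    have hdiff : Differentiable ℝ g := hg.differentiable one_ne_zero
    have cc : Continuous (fun p : ℝ × (Fin n → ℝ) => (Fin.cons p.1 p.2 : Fin (n+1) → ℝ)) := lbn_cons_contDiff.continuous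
    have dc : ∀ i, Continuous fun x => fderiv ℝ g x (Pi.single i 1) := fun i =>
      (hg.continuous_fderiv one_ne_zero).clm_apply continuous_const
    have dcc : ∀ i, Continuous fun p : ℝ × (Fin n → ℝ) => fderiv ℝ g (Fin.cons p.1 p.2) (Pi.single i 1) := 
      fun i => (dc i).comp cc
    have gcc : Continuous fun p : ℝ × (Fin n → ℝ) => g (Fin.cons p.1 p.2) := hg.continuous.comp cc
    obtain ⟨i1, e1⟩ := hI g B gcc.aestronglyMeasurable hB
    obtain ⟨i2, e2⟩ := hI (fun x => ‖g x‖^2) (B^2) (gcc.norm.pow 2).aestronglyMeasurable (fun x => by 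
      rw [Real.norm_of_nonneg (by positivity)]; gcongr; exact hB x)
    have h3 := fun i => hI (fun x => ‖fderiv ℝ g x (Pi.single i 1)‖^2) (C^2) ((dcc i).norm.pow 2).aestronglyMeasurable (fun x => by 
      rw [Real.norm_of_nonneg (by positivity)]; gcongr; exact hC x i)
    rw [e1, e2]
    simp only [fun i => (h3 i).2]
    -- slices
    have sl : ∀ t, ContDiff ℝ 1 (fun x : Fin n → ℝ => g (Fin.cons t x)) := fun t =>
      hg.comp (lbn_cons_contDiff.comp (contDiff_const.prodMk contDiff_id))
    have sld : ∀ t x i, fderiv ℝ (fun x : Fin n → ℝ => g (Fin.cons t x)) x (Pi.single i 1) = 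
        fderiv ℝ g (Fin.cons t x) (Pi.single i.succ 1) := by
      intro t x i
      rw [← ((sl t).differentiable one_ne_zero x).lineDeriv_eq_fderiv, 
        ← (hdiff _).lineDeriv_eq_fderiv]
      simp only [lineDeriv, lbn_cons_add]
    have s0 : ∀ t x, HasDerivAt (fun t => g (Fin.cons t x)) (fderiv ℝ g (Fin.cons t x) (Pi.single 0 1)) t := by
      intro t x
      have d : DifferentiableAt ℝ (fun t => g (Fin.cons t x)) t := 
        ((hg.comp (lbn_cons_contDiff.comp (contDiff_id.prodMk contDiff_const))).differentiable one_ne_zero) t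
      have : fderiv ℝ (fun t => g (Fin.cons t x)) t 1 = fderiv ℝ g (Fin.cons t x) (Pi.single 0 1) := by
        rw [← d.lineDeriv_eq_fderiv, ← (hdiff _).lineDeriv_eq_fderiv]
        simp only [lineDeriv, ← lbn_cons_add0, smul_eq_mul, mul_one]
      rw [← this]
      exact d.hasFDerivAt.hasDerivAt
    let gb : ℝ → ℂ := fun t => ∫ x, g (Fin.cons t x) ∂π
    have mk : ∀ t : ℝ, Continuous fun x : Fin n → ℝ => (t, x) := fun t => by fun_prop
    have gbd : ∀ t, HasDerivAt gb (∫ x, fderiv ℝ g (Fin.cons t x) (Pi.single 0 1) ∂π) t := by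
      intro t
      refine (hasDerivAt_integral_of_dominated_loc_of_deriv_le (F := fun t x => g (Fin.cons t x)) (bound := fun _ => C) (s := univ) univ_mem 
        (.of_forall fun s => (gcc.comp (mk s)).aestronglyMeasurable) ?_ 
        (F' := fun t x => fderiv ℝ g (Fin.cons t x) (Pi.single 0 1)) 
        ((dcc 0).comp (mk t)).aestronglyMeasurable 
        (.of_forall fun x s _ => hC _ _) (integrable_const _) (.of_forall fun x s _ => s0 s x)).2
      exact (integrable_const B).mono' (gcc.comp (mk t)).aestronglyMeasurable (.of_forall fun x => hB _)
    have bdI : ∀ (h : (Fin n → ℝ) → ℂ) (K : ℝ), (∀ x, ‖h x‖ ≤ K) → ‖∫ x, h x ∂π‖ ≤ K := by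
      intro h K hK
      simpa using norm_integral_le_of_norm_le_const (μ := π) (.of_forall hK)
    have o := lbn_oneD v hv gb (fun t => (gbd t).differentiableAt) B C (fun t => bdI _ _ fun x => hB _)
      (fun t => by rw [(gbd t).deriv]; exact bdI _ _ fun x => hC _ _)
    have o2 : ∫ t, ‖deriv gb t‖^2 ∂μ ≤ ∫ t, ∫ x, ‖fderiv ℝ g (Fin.cons t x) (Pi.single 0 1)‖^2 ∂π ∂μ := by
      refine integral_mono_of_nonneg (.of_forall fun t => by positivity) (h3 0).1.integral_prod_left (.of_forall fun t => ?_)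
      simp only [(gbd t).deriv]
      exact lbn_jensen π _ ((dcc 0).comp (mk t)).aestronglyMeasurable C fun x => hC _ _
    have gbi : Integrable (fun t => ‖gb t‖^2) μ := by
      refine (integrable_const (B^2)).mono' ?_ (.of_forall fun t => ?_)
      · have : Continuous gb := continuous_iff_continuousAt.2 fun t => (gbd t).continuousAt
        exact (this.norm.pow 2).aestronglyMeasurable
      · rw [Real.norm_of_nonneg (by positivity)]
        gcongr
        exact bdI _ _ fun x => hB _
    have si : Integrable (fun t => ∑ i : Fin n, ∫ x, ‖fderiv ℝ g (Fin.cons t x) (Pi.single i.succ 1)‖^2 ∂π) μ := 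
      integrable_finsetSum _ fun i _ => (h3 i.succ).1.integral_prod_left
    have step : ∫ t, ∫ x, ‖g (Fin.cons t x)‖^2 ∂π ∂μ ≤ ∫ t, (‖gb t‖^2 + v * ∑ i : Fin n, ∫ x, ‖fderiv ℝ g (Fin.cons t x) (Pi.single i.succ 1)‖^2 ∂π) ∂μ := by
      refine integral_mono i2.integral_prod_left (gbi.add (si.const_mul _)) fun t => ?_
      have := IH (fun x => g (Fin.cons t x)) (sl t) (fun x => hB _) (fun x i => by rw [sld]; exact hC _ _)
      simpa only [sld] using this
    rw [integral_add gbi (si.const_mul _), integral_const_mul, integral_finsetSum _ fun i _ => (h3 i.succ).1.integral_prod_left] at step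
    rw [Fin.sum_univ_succ, mul_add]
    have hv0 : (0:ℝ) ≤ v := v.2
    have := mul_le_mul_of_nonneg_left o2 hv0
    linarith

open ProbabilityTheory Set Filter Topology NNReal in
lemma lbn_density (v : ℝ≥0) (hv : v ≠ 0) (n : ℕ) :
    (Measure.pi fun _ : Fin n => gaussianReal 0 v) =
      (volume : Measure (Fin n → ℝ)).withDensity
        (fun x => ENNReal.ofReal (∏ i, gaussianPDFReal 0 v (x i))) := by
  refine Measure.pi_eq fun s hs => ?_
  have hi : Integrable (fun x : Fin n → ℝ => ∏ i, gaussianPDFReal 0 v (x i)) :=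
    Integrable.fintype_prod (f := fun _ => gaussianPDFReal 0 v) (fun i => integrable_gaussianPDFReal 0 v)
  rw [withDensity_apply _ (MeasurableSet.univ_pi hs),
    ← ofReal_integral_eq_lintegral_ofReal hi.integrableOn
      (.of_forall fun x => Finset.prod_nonneg fun i _ => gaussianPDFReal_nonneg _ _ _)]
  rw [volume_pi, Measure.restrict_pi_pi,
    integral_fintype_prod_eq_prod (μ := fun i => volume.restrict (s i)) (fun _ => gaussianPDFReal 0 v)]
  rw [ENNReal.ofReal_prod_of_nonneg (fun i _ => integral_nonneg fun x => gaussianPDFReal_nonneg _ _ _)]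
  refine Finset.prod_congr rfl fun i _ => ?_
  rw [gaussianReal_apply_eq_integral 0 hv]

open ProbabilityTheory Set Filter Topology NNReal in
lemma lbn_gauss (n : ℕ) (G : EuclideanSpace ℝ (Fin n) → ℂ) (hG : ContDiff ℝ 1 G)
    (hc : HasCompactSupport G) (τ : ℝ) (hτ : 0 < τ)
    (hmean : ∫ x : EuclideanSpace ℝ (Fin n), Real.exp (-(τ * ‖x‖ ^ 2)) • G x = 0) :
    2 * τ * ∫ x : EuclideanSpace ℝ (Fin n), Real.exp (-(τ * ‖x‖ ^ 2)) * ‖G x‖ ^ 2 ≤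
      ∫ x : EuclideanSpace ℝ (Fin n), Real.exp (-(τ * ‖x‖ ^ 2)) *
        ∑ j : Fin n, ‖fderiv ℝ G x (EuclideanSpace.single j 1)‖ ^ 2 := by
  set v : ℝ≥0 := ⟨1 / (2 * τ), by positivity⟩ with hvdef
  have hvv : (v : ℝ) = 1 / (2 * τ) := rfl
  have hv0 : (0:ℝ) < v := by rw [hvv]; positivity
  have hv : v ≠ 0 := by
    intro h; rw [h] at hv0; simp at hv0
  set k : ℝ := ((√(2 * Real.pi * v))⁻¹) ^ n with hk
  have hk0 : 0 < k := by positivity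
  have hprod : ∀ x : Fin n → ℝ, ∏ i, gaussianPDFReal 0 v (x i) = 
      k * Real.exp (-(τ * ‖(WithLp.toLp 2 x : EuclideanSpace ℝ (Fin n))‖^2)) := by
    intro x
    simp only [gaussianPDFReal_def]
    rw [Finset.prod_mul_distrib, ← Real.exp_sum]
    congr 1
    · simp [hk]
    · rw [EuclideanSpace.norm_sq_eq]
      congr 1
      rw [Finset.mul_sum, ← Finset.sum_neg_distrib]
      refine Finset.sum_congr rfl fun i _ => ?_
      simp only [Real.norm_eq_abs, sq_abs, hvv]
      field_simp
      ring
  have hI : ∀ {E : Type} [NormedAddCommGroup E] [NormedSpace ℝ E] (h : EuclideanSpace ℝ (Fin n) → E),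
      ∫ x, h (WithLp.toLp 2 x) ∂(Measure.pi fun _ : Fin n => gaussianReal 0 v) = 
      k • ∫ x : EuclideanSpace ℝ (Fin n), Real.exp (-(τ * ‖x‖ ^ 2)) • h x := by
    intro E _ _ h
    have mm : Measurable (fun x : Fin n → ℝ => ∏ i, gaussianPDFReal 0 v (x i)) := 
      Finset.measurable_prod _ fun i _ => (measurable_gaussianPDFReal 0 v).comp (measurable_pi_apply i)
    rw [lbn_density v hv n, integral_withDensity_eq_integral_toReal_smul mm.ennreal_ofReal (.of_forall fun x => ENNReal.ofReal_lt_top)]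
    rw [← (PiLp.volume_preserving_toLp (Fin n)).integral_comp (MeasurableEquiv.toLp 2 _).measurableEmbedding, ← integral_smul]
    congr 1; ext x
    rw [ENNReal.toReal_ofReal (Finset.prod_nonneg fun i _ => gaussianPDFReal_nonneg _ _ _), hprod, mul_smul]
  obtain ⟨B, hB⟩ := hc.exists_bound_of_continuous hG.continuous
  obtain ⟨C, hC⟩ := (hc.fderiv ℝ).exists_bound_of_continuous (hG.continuous_fderiv one_ne_zero)
  have hg : ContDiff ℝ 1 (fun x : Fin n → ℝ => G (WithLp.toLp 2 x)) := 
    hG.comp (PiLp.contDiff_toLp)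
  have hgd : ∀ x i, fderiv ℝ (fun x : Fin n → ℝ => G (WithLp.toLp 2 x)) x (Pi.single i 1) = 
      fderiv ℝ G (WithLp.toLp 2 x) (EuclideanSpace.single i 1) := by
    intro x i
    rw [← (hg.differentiable one_ne_zero x).lineDeriv_eq_fderiv, 
        ← (hG.differentiable one_ne_zero _).lineDeriv_eq_fderiv]
    rfl
  have dC : ∀ x (i : Fin n), ‖fderiv ℝ G x (EuclideanSpace.single i 1)‖ ≤ C := fun x i => by
    refine ((fderiv ℝ G x).le_opNorm _).trans ?_
    simpa using hC x
  have P := lbn_pi v hv B C n (fun x : Fin n → ℝ => G (WithLp.toLp 2 x)) hg (fun x => hB _)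
    (fun x i => by rw [hgd]; exact dC _ _)
  simp only [hgd] at P
  rw [hI (fun x => ‖G x‖^2), hI G, hmean] at P
  simp only [fun i => hI (fun x => ‖fderiv ℝ G x (EuclideanSpace.single i 1)‖^2), smul_eq_mul] at P
  have ci : ∀ i : Fin n, Integrable (fun x : EuclideanSpace ℝ (Fin n) => Real.exp (-(τ * ‖x‖ ^ 2)) * ‖fderiv ℝ G x (EuclideanSpace.single i 1)‖^2) := by
    intro i
    refine Continuous.integrable_of_hasCompactSupport ?_ ?_
    · have : Continuous fun x => fderiv ℝ G x (EuclideanSpace.single i 1) :=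
        (hG.continuous_fderiv one_ne_zero).clm_apply continuous_const
      fun_prop
    · refine ((hc.fderiv ℝ).mono ?_)
      intro x hx
      rw [Function.mem_support] at hx ⊢
      contrapose! hx
      simp [hx]
  simp only [Finset.mul_sum]
  rw [integral_finsetSum _ fun i _ => ci i]
  simp only [smul_zero, norm_zero, ← Finset.mul_sum] at P
  rw [hvv] at P
  set X := ∫ x : EuclideanSpace ℝ (Fin n), Real.exp (-(τ * ‖x‖ ^ 2)) * ‖G x‖ ^ 2
  set Y := ∑ i : Fin n, ∫ x : EuclideanSpace ℝ (Fin n), Real.exp (-(τ * ‖x‖ ^ 2)) * ‖fderiv ℝ G x (EuclideanSpace.single i 1)‖^2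
  have P2 : k * X ≤ k * (1 / (2 * τ) * Y) := by linarith
  have P3 := le_of_mul_le_mul_left P2 hk0
  rw [div_mul_eq_mul_div, one_mul, le_div_iff₀ (by positivity)] at P3
  linarith

open Set Filter Topology in
lemma lbn_integrable (n : ℕ) (hn : 3 ≤ n) (h : EuclideanSpace ℝ (Fin n) → ℝ)
    (hm : AEStronglyMeasurable h volume) (K R : ℝ)
    (hb : ∀ x, |h x| ≤ K * (‖x‖ ^ 2)⁻¹) (hR : ∀ x, R ≤ ‖x‖ → h x = 0) : Integrable h := by
  have : Nonempty (Fin n) := ⟨⟨0, by omega⟩⟩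
  have h1 : IntegrableOn (fun x : EuclideanSpace ℝ (Fin n) => (‖x‖ ^ 2)⁻¹) (Metric.ball 0 R) := by
    rw [integrableOn_fun_norm_addHaar volume (f := fun y : ℝ => (y ^ 2)⁻¹)]
    have c : IntegrableOn (fun y : ℝ => y ^ (n - 3)) (Ioo 0 R) :=
      ((continuous_pow (n-3)).continuousOn.integrableOn_compact isCompact_Icc).mono_set Ioo_subset_Icc_self
    refine (integrableOn_congr_fun (fun y hy => ?_) measurableSet_Ioo).1 c
    have hy : 0 < y := hy.1
    simp only [finrank_euclideanSpace, Fintype.card_fin, smul_eq_mul]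
    rw [show n - 1 = (n - 3) + 2 by omega, pow_add]
    field_simp
  have h2 : IntegrableOn h (Metric.ball 0 R) :=
    (h1.const_mul K).mono' hm.restrict (.of_forall fun x => hb x)
  rw [← integrableOn_univ]
  refine h2.of_forall_sdiff_eq_zero MeasurableSet.univ fun x hx => hR x ?_
  simpa using hx

open Set Filter Topology in
lemma lbn_polar (n : ℕ) {F : Type*} [NormedAddCommGroup F] [NormedSpace ℝ F]
    (h : EuclideanSpace ℝ (Fin n) → F) (hn : 3 ≤ n) (hi : Integrable h) :
    Integrable (fun p : Metric.sphere (0 : EuclideanSpace ℝ (Fin n)) 1 × Ioi (0:ℝ) =>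
      h ((p.2 : ℝ) • (p.1 : EuclideanSpace ℝ (Fin n))))
      ((volume : Measure (EuclideanSpace ℝ (Fin n))).toSphere.prod (Measure.volumeIoiPow (n - 1))) ∧
    ∫ x, h x = ∫ p : Metric.sphere (0 : EuclideanSpace ℝ (Fin n)) 1 × Ioi (0:ℝ),
      h ((p.2 : ℝ) • (p.1 : EuclideanSpace ℝ (Fin n)))
      ∂((volume : Measure (EuclideanSpace ℝ (Fin n))).toSphere.prod (Measure.volumeIoiPow (n - 1))) := by
  have : Nonempty (Fin n) := ⟨⟨0, by omega⟩⟩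
  have mp := (volume : Measure (EuclideanSpace ℝ (Fin n))).measurePreserving_homeomorphUnitSphereProd
  simp only [finrank_euclideanSpace, Fintype.card_fin] at mp
  have emb := (homeomorphUnitSphereProd (EuclideanSpace ℝ (Fin n))).measurableEmbedding
  have key : ∀ x : ({0}ᶜ : Set (EuclideanSpace ℝ (Fin n))),
    (((homeomorphUnitSphereProd (EuclideanSpace ℝ (Fin n)) x).2 : ℝ)) • 
      ((homeomorphUnitSphereProd (EuclideanSpace ℝ (Fin n)) x).1 : EuclideanSpace ℝ (Fin n)) = x := by
    intro x
    have hx : ‖(x : EuclideanSpace ℝ (Fin n))‖ ≠ 0 := norm_ne_zero_iff.2 x.2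
    simp [smul_smul, hx]
  constructor
  · rw [← mp.integrable_comp_emb emb]
    simp only [Function.comp_def, key]
    rw [← restrict_compl_singleton (μ := (volume : Measure (EuclideanSpace ℝ (Fin n)))) 0, ← IntegrableOn,
      integrableOn_iff_comap_subtypeVal (by measurability)] at hi
    exact hi
  · rw [← mp.integral_comp emb]
    simp only [key]
    rw [integral_subtype_comap (measurableSet_singleton _).compl h, restrict_compl_singleton]

open Set Filter Topology in
lemma lbn_mean (n : ℕ) (hn : 3 ≤ n) (f : EuclideanSpace ℝ (Fin n) → ℂ) (k : ℝ → ℝ)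
    (hrad : ∀ x, sphericalAvg n f x = 0) (hi : Integrable (fun x => k ‖x‖ • f x)) :
    ∫ x, k ‖x‖ • f x = 0 := by
  have : Nonempty (Fin n) := ⟨⟨0, by omega⟩⟩
  have : Nontrivial (EuclideanSpace ℝ (Fin n)) := inferInstance
  obtain ⟨i1, e1⟩ := lbn_polar n _ hn hi
  rw [e1, integral_prod_symm _ i1]
  refine integral_eq_zero_of_ae (.of_forall fun r => ?_)
  have hr : (0:ℝ) < r := r.2
  have hnorm : ∀ θ : Metric.sphere (0 : EuclideanSpace ℝ (Fin n)) 1, 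
      ‖(r:ℝ) • (θ : EuclideanSpace ℝ (Fin n))‖ = r := by
    intro θ
    rw [norm_smul, norm_eq_of_mem_sphere, Real.norm_of_nonneg hr.le, mul_one]
  simp only [hnorm, Pi.zero_apply]
  rw [integral_smul]
  obtain ⟨x, hx⟩ := exists_norm_eq (EuclideanSpace ℝ (Fin n)) hr.le
  have h := hrad x
  rw [sphericalAvg, hx, smul_eq_zero] at h
  rcases h with h | h
  · exfalso
    have h0 := (volume : Measure (EuclideanSpace ℝ (Fin n))).toSphere_ne_zero
    rw [inv_eq_zero, sphereArea, ENNReal.toReal_eq_zero_iff] at h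
    rcases h with h | h
    · exact h0 (Measure.measure_univ_eq_zero.1 h)
    · exact measure_ne_top _ _ h
  · rw [h, smul_zero]

open Set Filter Topology in
lemma lbn_ibp (n : ℕ) (hn : 3 ≤ n) (f : EuclideanSpace ℝ (Fin n) → ℂ)
    (hf : ContDiff ℝ 1 f) (hsupp : HasCompactSupport f)
    (hi : Integrable (fun x => (2 * inner ℝ (f x) (fderiv ℝ f x x) + ((n:ℝ) - 2) * ‖f x‖ ^ 2) * (‖x‖ ^ 2)⁻¹)) :
    ∫ x, (2 * inner ℝ (f x) (fderiv ℝ f x x) + ((n:ℝ) - 2) * ‖f x‖ ^ 2) * (‖x‖ ^ 2)⁻¹ = 0 := by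
  obtain ⟨i1, e1⟩ := lbn_polar n _ hn hi
  rw [e1, integral_prod _ i1]
  refine integral_eq_zero_of_ae (.of_forall fun θ => ?_)
  have hθ : ‖(θ : EuclideanSpace ℝ (Fin n))‖ = 1 := norm_eq_of_mem_sphere θ
  simp only [Measure.volumeIoiPow, Pi.zero_apply]
  have mm : Measurable (fun r : Ioi (0:ℝ) => ENNReal.ofReal ((r:ℝ) ^ (n-1))) := by fun_prop
  rw [integral_withDensity_eq_integral_toReal_smul mm (.of_forall fun r => ENNReal.ofReal_lt_top)]
  let H : ℝ → ℝ := fun r => r ^ (n-2) * ‖f (r • (θ : EuclideanSpace ℝ (Fin n)))‖ ^ 2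
  have hfd := hf.differentiable one_ne_zero
  have hH : ContDiff ℝ 1 H := 
    (contDiff_id.pow _).mul ((hf.comp (contDiff_id.smul contDiff_const)).norm_sq ℝ)
  have hHc : HasCompactSupport H := by
    obtain ⟨R, hR⟩ := hsupp.isBounded.subset_closedBall (0 : EuclideanSpace ℝ (Fin n))
    refine HasCompactSupport.intro (isCompact_closedBall (0:ℝ) R) fun r hr => ?_
    have : f (r • (θ : EuclideanSpace ℝ (Fin n))) = 0 := by
      by_contra h
      have := hR (subset_tsupport _ h)
      simp [norm_smul, hθ] at this hr
      linarith
    simp [H, this]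
  have hd : ∀ r ∈ Ioi (0:ℝ), deriv H r = r ^ (n-1) * 
    ((2 * inner ℝ (f (r • (θ : EuclideanSpace ℝ (Fin n)))) 
      (fderiv ℝ f (r • (θ : EuclideanSpace ℝ (Fin n))) (r • (θ : EuclideanSpace ℝ (Fin n)))) 
      + ((n:ℝ) - 2) * ‖f (r • (θ : EuclideanSpace ℝ (Fin n)))‖ ^ 2) * (‖r • (θ : EuclideanSpace ℝ (Fin n))‖ ^ 2)⁻¹) := by
    intro r hr
    have hr : 0 < r := hr
    have d1 : HasDerivAt (fun r : ℝ => f (r • (θ : EuclideanSpace ℝ (Fin n)))) 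
      (fderiv ℝ f (r • (θ : EuclideanSpace ℝ (Fin n))) (θ : EuclideanSpace ℝ (Fin n))) r := by
      have := (hfd (r • (θ : EuclideanSpace ℝ (Fin n)))).hasFDerivAt.comp_hasDerivAt r 
        ((hasDerivAt_id r).smul_const (θ : EuclideanSpace ℝ (Fin n)))
      simp only [id, one_smul] at this
      exact this
    have d2 := (hasDerivAt_pow (n-2) r).mul d1.norm_sq
    have : deriv H r = _ := d2.deriv
    rw [this, map_smul, inner_smul_right, norm_smul, hθ, Real.norm_of_nonneg hr.le, 
      show n - 1 = (n - 3) + 2 by omega, show n - 2 - 1 = n - 3 by omega, show n - 2 = (n-3)+1 by omega]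
    have : (n:ℝ) = ((n-3 : ℕ) : ℝ) + 3 := by rw [Nat.cast_sub hn]; norm_num
    rw [this]
    push_cast
    field_simp
    ring
  have e : ∫ r in Ioi (0:ℝ), deriv H r = 0 := by
    rw [hHc.integral_Ioi_deriv_eq hH 0]
    have : n - 2 ≠ 0 := by omega
    simp [H, this]
  rw [setIntegral_congr_fun measurableSet_Ioi hd, ← integral_subtype_comap measurableSet_Ioi] at e
  refine Eq.trans ?_ e
  refine integral_congr_ae (.of_forall fun r => ?_)
  simp only []
  have hr : (0:ℝ) < r := r.2
  rw [ENNReal.toReal_ofReal (by positivity), smul_eq_mul]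

open Set Filter Topology in
lemma lbn_gamma (a R c : ℝ) (ha : 0 < a) (hR : 0 < R) (hc : 0 ≤ c) :
    ∫⁻ t in Ioi (0:ℝ), ENNReal.ofReal (t ^ (a - 1) * (Real.exp (-(t * R)) * c)) =
      ENNReal.ofReal ((1 / R) ^ a * Real.Gamma a * c) := by
  have h := Real.integral_rpow_mul_exp_neg_mul_Ioi ha hR
  have hG := Real.Gamma_pos_of_pos ha
  have hne : (1 / R) ^ a * Real.Gamma a ≠ 0 := by positivity
  have hi : Integrable (fun t : ℝ => t ^ (a - 1) * Real.exp (-(R * t))) (volume.restrict (Ioi 0)) := by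
    refine Integrable.of_integral_ne_zero ?_
    rw [h]; exact hne
  have hi2 : Integrable (fun t : ℝ => t ^ (a - 1) * (Real.exp (-(t * R)) * c)) (volume.restrict (Ioi 0)) := by
    refine (hi.mul_const c).congr (.of_forall fun t => ?_)
    simp only [mul_comm t R, mul_assoc]
  rw [← ofReal_integral_eq_lintegral_ofReal hi2]
  · rw [← h, ← integral_mul_const]
    congr 2; ext t
    rw [mul_comm t R, mul_assoc]
  · refine (ae_restrict_iff' measurableSet_Ioi).2 (.of_forall fun t ht => ?_)
    have ht : 0 < t := ht
    simp only [Pi.zero_apply]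
    positivity

open Set Filter Topology in
lemma lbn_integrable_f (n : ℕ) (hn : 3 ≤ n) (f : EuclideanSpace ℝ (Fin n) → ℂ)
    (hf : ContDiff ℝ 1 f) (hsupp : HasCompactSupport f) :
    Integrable (fun x => (‖x‖ ^ 2)⁻¹ * ‖f x‖ ^ 2) ∧ 
    Integrable (fun x => (‖x‖ ^ 2)⁻¹ * inner ℝ (f x) (fderiv ℝ f x x)) ∧ 
    Integrable (fun x => ∑ j : Fin n, ‖fderiv ℝ f x (EuclideanSpace.single j 1)‖ ^ 2) := by
  have c1 : Continuous fun x => fderiv ℝ f x x := (hf.continuous_fderiv one_ne_zero).clm_apply continuous_id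
  have cf := hf.continuous
  obtain ⟨R, hR⟩ := hsupp.isBounded.subset_ball (0 : EuclideanSpace ℝ (Fin n))
  have hz : ∀ x, R ≤ ‖x‖ → f x = 0 := by
    intro x hx
    by_contra h
    have := hR (subset_tsupport _ h)
    simp at this
    linarith
  refine ⟨?_, ?_, ?_⟩
  · have c2 : Continuous fun x => ‖f x‖^2 := by fun_prop
    obtain ⟨K, hK⟩ := (hsupp.norm.comp_left (g := fun y : ℝ => y^2) (by simp)).exists_bound_of_continuous c2
    refine lbn_integrable n hn _ ?_ K R (fun x => ?_) (fun x hx => by simp [hz x hx])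
    · exact (Measurable.aestronglyMeasurable (by fun_prop))
    · rw [abs_mul, abs_of_nonneg (by positivity : 0 ≤ (‖x‖^2)⁻¹), mul_comm]
      gcongr
      exact hK x
  · have c2 : Continuous fun x => (inner ℝ (f x) (fderiv ℝ f x x) : ℝ) := cf.inner c1
    have s2 : HasCompactSupport fun x => (inner ℝ (f x) (fderiv ℝ f x x) : ℝ) := by
      refine hsupp.mono ?_
      intro x hx
      rw [Function.mem_support] at hx ⊢
      contrapose! hx
      simp [hx]
    obtain ⟨K, hK⟩ := s2.exists_bound_of_continuous c2
    refine lbn_integrable n hn _ ?_ K R (fun x => ?_) (fun x hx => by simp [hz x hx])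
    · exact (Measurable.aestronglyMeasurable (by have := c2.measurable; fun_prop))
    · rw [abs_mul, abs_of_nonneg (by positivity : 0 ≤ (‖x‖^2)⁻¹), mul_comm]
      gcongr
      exact hK x
  · refine integrable_finsetSum _ fun i _ => Continuous.integrable_of_hasCompactSupport ?_ ?_
    · have : Continuous fun x => fderiv ℝ f x (EuclideanSpace.single i 1) :=
        (hf.continuous_fderiv one_ne_zero).clm_apply continuous_const
      fun_prop
    · refine ((hsupp.fderiv ℝ).mono ?_)
      intro x hx
      rw [Function.mem_support] at hx ⊢
      contrapose! hx
      simp [hx]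

open Set Filter Topology in
lemma lbn_grad (n : ℕ) (hn : 3 ≤ n) (f : EuclideanSpace ℝ (Fin n) → ℂ)
    (hf : ContDiff ℝ 1 f) (x : EuclideanSpace ℝ (Fin n)) (hx : x ≠ 0) :
    ∑ j : Fin n, ‖fderiv ℝ (fun x => ‖x‖ ^ ((n:ℝ)/2) • f x) x (EuclideanSpace.single j 1)‖ ^ 2 =
    (‖x‖ ^ ((n:ℝ)/2)) ^ 2 * (∑ j : Fin n, ‖fderiv ℝ f x (EuclideanSpace.single j 1)‖ ^ 2 + 
      n * ((‖x‖^2)⁻¹ * inner ℝ (f x) (fderiv ℝ f x x)) + (n:ℝ)^2 / 4 * ((‖x‖^2)⁻¹ * ‖f x‖^2)) := by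
  have hp : 1 < (n:ℝ)/2 := by
    have : (3:ℝ) ≤ n := by exact_mod_cast hn
    linarith
  have hN : 0 < ‖x‖ := norm_pos_iff.2 hx
  set a := ‖x‖ ^ ((n:ℝ)/2) with ha
  have ha2 : ‖x‖ ^ ((n:ℝ)/2 - 2) = a / ‖x‖^2 := by
    rw [Real.rpow_sub hN]; norm_num [ha]
  have hd := (hasFDerivAt_norm_rpow x hp).smul (hf.differentiable one_ne_zero x).hasFDerivAt
  have hd' : fderiv ℝ (fun x => ‖x‖ ^ ((n:ℝ)/2) • f x) x = _ := hd.fderiv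
  have each : ∀ j, ‖fderiv ℝ (fun x => ‖x‖ ^ ((n:ℝ)/2) • f x) x (EuclideanSpace.single j 1)‖ ^ 2 = 
     a ^ 2 * (‖fderiv ℝ f x (EuclideanSpace.single j 1)‖ ^ 2 
      + n * ((‖x‖^2)⁻¹ * inner ℝ (f x) (x j • fderiv ℝ f x (EuclideanSpace.single j 1))) 
      + (n:ℝ)^2 / 4 * ((‖x‖^2)⁻¹ * ‖f x‖^2) * ((‖x‖^2)⁻¹ * (x j)^2)) := by
    intro j
    rw [hd']
    simp only [ha2, ← ha, ContinuousLinearMap.add_apply, ContinuousLinearMap.smul_apply, 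
      ContinuousLinearMap.smulRight_apply, innerSL_apply_apply, EuclideanSpace.inner_single_right, smul_eq_mul]
    rw [norm_add_sq_real, norm_smul, norm_smul, inner_smul_left, inner_smul_right, inner_smul_right, mul_pow, mul_pow, 
      Real.norm_eq_abs, Real.norm_eq_abs, sq_abs, sq_abs, real_inner_comm]
    simp
    field_simp
    ring
  simp only [each]
  rw [← Finset.mul_sum, Finset.sum_add_distrib, Finset.sum_add_distrib, ← Finset.mul_sum, ← Finset.mul_sum, ← Finset.mul_sum, ← Finset.mul_sum,
    ← inner_sum]
  have e1 : ∑ j, x j • fderiv ℝ f x (EuclideanSpace.single j 1) = fderiv ℝ f x x := by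
    generalize fderiv ℝ f x = L
    conv_rhs => rw [← (EuclideanSpace.basisFun (Fin n) ℝ).sum_repr x]
    simp only [map_sum, map_smul, EuclideanSpace.basisFun_repr, EuclideanSpace.basisFun_apply]
  have e2 : ∑ j, (x j)^2 = ‖x‖^2 := by rw [EuclideanSpace.norm_sq_eq]; simp
  rw [e1, e2]
  field_simp

set_option maxHeartbeats 3000000 in
open Set Filter Topology in
lemma lbn_hardy (n : ℕ) (hn : 3 ≤ n) (f : EuclideanSpace ℝ (Fin n) → ℂ)
    (hf : ContDiff ℝ 1 f) (hsupp : HasCompactSupport f)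
    (hrad : ∀ x, sphericalAvg n f x = 0) :
    (n:ℝ)^2 / 4 * ∫ x : EuclideanSpace ℝ (Fin n), (‖x‖ ^ 2)⁻¹ * ‖f x‖ ^ 2 ≤
      ∫ x : EuclideanSpace ℝ (Fin n), ∑ j : Fin n, ‖fderiv ℝ f x (EuclideanSpace.single j 1)‖ ^ 2 := by
  have : Nonempty (Fin n) := ⟨⟨0, by omega⟩⟩
  obtain ⟨iA, iJ, iD⟩ := lbn_integrable_f n hn f hf hsupp
  have hn3 : (3:ℝ) ≤ n := by exact_mod_cast hn
  have hp : 1 < (n:ℝ)/2 := by linarith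
  set p := (n:ℝ)/2 with hpdef
  let G : EuclideanSpace ℝ (Fin n) → ℂ := fun x => ‖x‖ ^ p • f x
  have hG : ContDiff ℝ 1 G := (contDiff_norm_rpow hp).smul hf
  have hGc : HasCompactSupport G := HasCompactSupport.smul_left (f := fun x : EuclideanSpace ℝ (Fin n) => ‖x‖ ^ p) hsupp
  let S : EuclideanSpace ℝ (Fin n) → ℝ := fun x => ∑ j : Fin n, ‖fderiv ℝ G x (EuclideanSpace.single j 1)‖ ^ 2
  have S0 : ∀ x, 0 ≤ S x := fun x => Finset.sum_nonneg fun j _ => by positivity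
  have Sc : Continuous S := by
    refine continuous_finsetSum _ fun j _ => ?_
    have : Continuous fun x => fderiv ℝ G x (EuclideanSpace.single j 1) :=
        (hG.continuous_fderiv one_ne_zero).clm_apply continuous_const
    fun_prop
  have Ssupp : HasCompactSupport S := by
    refine ((hGc.fderiv ℝ).mono ?_)
    intro x hx
    rw [Function.mem_support] at hx ⊢
    contrapose! hx
    simp [S, hx]
  have Gc := hG.continuous
  let E : ℝ → EuclideanSpace ℝ (Fin n) → ℝ := fun t x => Real.exp (-(t * ‖x‖^2))
  have Ec : ∀ t, Continuous (E t) := fun t => by simp only [E]; fun_prop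
  have step1 : ∀ t ∈ Ioi (0:ℝ), ∫⁻ x, ENNReal.ofReal (t ^ (p + 1 - 1) * (E t x * (2 * ‖G x‖^2))) ≤ 
      ∫⁻ x, ENNReal.ofReal (t ^ (p - 1) * (E t x * S x)) := by
    intro t ht
    have ht : 0 < t := ht
    have i1 : Integrable (fun x => E t x * ‖G x‖^2) := by
      refine Continuous.integrable_of_hasCompactSupport (by have := Ec t; fun_prop) ?_
      exact (hGc.norm.comp_left (g := fun y : ℝ => y^2) (by simp)).mul_left
    have i2 : Integrable (fun x => E t x * S x) := 
      Continuous.integrable_of_hasCompactSupport ((Ec t).mul Sc) Ssupp.mul_left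
    have i1' : Integrable (fun x => t ^ (p + 1 - 1) * (E t x * (2 * ‖G x‖^2))) := by
      refine (i1.const_mul (t ^ (p + 1 - 1) * 2)).congr (.of_forall fun x => ?_)
      simp only []; ring
    rw [← ofReal_integral_eq_lintegral_ofReal i1' (.of_forall fun x => by simp only [E, Pi.zero_apply]; positivity), 
      ← ofReal_integral_eq_lintegral_ofReal (i2.const_mul _) (.of_forall fun x => 
        mul_nonneg (by positivity) (mul_nonneg (Real.exp_nonneg _) (S0 x)))]
    apply ENNReal.ofReal_le_ofReal
    have i3 : Integrable (fun x => E t x • G x) := 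
      Continuous.integrable_of_hasCompactSupport ((Ec t).smul Gc) (HasCompactSupport.smul_left (f := E t) hGc)
    have hmean : ∫ x : EuclideanSpace ℝ (Fin n), Real.exp (-(t * ‖x‖ ^ 2)) • G x = 0 := by
      have := lbn_mean n hn f (fun r => Real.exp (-(t * r ^ 2)) * r ^ p) hrad (by simpa only [mul_smul] using i3)
      simpa only [mul_smul] using this
    have g := lbn_gauss n G hG hGc t ht hmean
    have e1 : ∫ x, t ^ (p + 1 - 1) * (E t x * (2 * ‖G x‖^2)) = t ^ (p-1) * (2 * t * ∫ x, E t x * ‖G x‖^2) := by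
      rw [← integral_const_mul, ← integral_const_mul]
      congr 1; ext x
      have : t ^ (p + 1 - 1) = t ^ (p-1) * t := by
        rw [← Real.rpow_add_one ht.ne']; congr 1; ring
      rw [this]; ring
    rw [e1, integral_const_mul]
    gcongr
  have step2 : ∫⁻ t in Ioi (0:ℝ), ∫⁻ x, ENNReal.ofReal (t ^ (p + 1 - 1) * (E t x * (2 * ‖G x‖^2))) ≤ 
      ∫⁻ t in Ioi (0:ℝ), ∫⁻ x, ENNReal.ofReal (t ^ (p - 1) * (E t x * S x)) :=
    setLIntegral_mono' measurableSet_Ioi step1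
  have Em : Measurable fun q : ℝ × EuclideanSpace ℝ (Fin n) => E q.1 q.2 := by
    simp only [E]; fun_prop
  have Sm := Sc.measurable
  have Gm := Gc.measurable
  have sw1 : ∫⁻ t in Ioi (0:ℝ), ∫⁻ x, ENNReal.ofReal (t ^ (p + 1 - 1) * (E t x * (2 * ‖G x‖^2))) =
      ∫⁻ x, ∫⁻ t in Ioi (0:ℝ), ENNReal.ofReal (t ^ (p + 1 - 1) * (E t x * (2 * ‖G x‖^2))) :=
    lintegral_lintegral_swap (by
      refine Measurable.aemeasurable ?_
      simp only [Function.uncurry_def]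
      fun_prop)
  have sw2 : ∫⁻ t in Ioi (0:ℝ), ∫⁻ x, ENNReal.ofReal (t ^ (p - 1) * (E t x * S x)) =
      ∫⁻ x, ∫⁻ t in Ioi (0:ℝ), ENNReal.ofReal (t ^ (p - 1) * (E t x * S x)) :=
    lintegral_lintegral_swap (by
      refine Measurable.aemeasurable ?_
      simp only [Function.uncurry_def]
      fun_prop)
  rw [sw1, sw2] at step2
  have hΓ : 0 < Real.Gamma p := Real.Gamma_pos_of_pos (by linarith)
  have ae0 : ∀ᵐ x : EuclideanSpace ℝ (Fin n), x ≠ 0 := by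
    have := Measure.ae_ne (volume : Measure (EuclideanSpace ℝ (Fin n))) 0
    exact this
  let T : EuclideanSpace ℝ (Fin n) → ℝ := fun x => ∑ j : Fin n, ‖fderiv ℝ f x (EuclideanSpace.single j 1)‖ ^ 2 + 
      n * ((‖x‖^2)⁻¹ * inner ℝ (f x) (fderiv ℝ f x x)) + (n:ℝ)^2 / 4 * ((‖x‖^2)⁻¹ * ‖f x‖^2)
  have rp : ∀ x : EuclideanSpace ℝ (Fin n), x ≠ 0 → (1 / ‖x‖^2) ^ p = ((‖x‖ ^ p)^2)⁻¹ := by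
    intro x hx
    have hN : 0 < ‖x‖ := norm_pos_iff.2 hx
    rw [one_div, Real.inv_rpow (by positivity), ← Real.rpow_natCast, ← Real.rpow_natCast, ← Real.rpow_mul hN.le, 
      ← Real.rpow_mul hN.le, mul_comm]
  have L : ∀ x : EuclideanSpace ℝ (Fin n), x ≠ 0 → 
      ∫⁻ t in Ioi (0:ℝ), ENNReal.ofReal (t ^ (p + 1 - 1) * (E t x * (2 * ‖G x‖^2))) = 
      ENNReal.ofReal (Real.Gamma p * (n * ((‖x‖^2)⁻¹ * ‖f x‖^2))) := by
    intro x hx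
    have hN : 0 < ‖x‖ := norm_pos_iff.2 hx
    rw [lbn_gamma (p+1) (‖x‖^2) _ (by linarith) (by positivity) (by positivity)]
    congr 1
    rw [Real.rpow_add_one (by positivity), Real.Gamma_add_one (by positivity), rp x hx]
    simp only [G, norm_smul]
    rw [Real.norm_of_nonneg (by positivity), hpdef]
    have : 0 < ‖x‖ ^ ((n:ℝ)/2) := by positivity
    field_simp
  have Rr : ∀ x : EuclideanSpace ℝ (Fin n), x ≠ 0 → 0 ≤ T x ∧ 
      ∫⁻ t in Ioi (0:ℝ), ENNReal.ofReal (t ^ (p - 1) * (E t x * S x)) = 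
      ENNReal.ofReal (Real.Gamma p * T x) := by
    intro x hx
    have hN : 0 < ‖x‖ := norm_pos_iff.2 hx
    have hS : S x = (‖x‖ ^ p)^2 * T x := lbn_grad n hn f hf x hx
    have hq : 0 < (‖x‖ ^ p)^2 := by positivity
    constructor
    · have := S0 x
      rw [hS] at this
      exact nonneg_of_mul_nonneg_right this hq
    rw [lbn_gamma p (‖x‖^2) _ (by linarith) (by positivity) (S0 x), rp x hx, hS]
    congr 1
    field_simp
  rw [lintegral_congr_ae (ae0.mono fun x hx => L x hx), lintegral_congr_ae (ae0.mono fun x hx => (Rr x hx).2)] at step2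
  have iT : Integrable T := (iD.add (iJ.const_mul _)).add (iA.const_mul _)
  rw [← ofReal_integral_eq_lintegral_ofReal ((iA.const_mul _).const_mul _) (.of_forall fun x => by simp only [Pi.zero_apply]; positivity),
    ← ofReal_integral_eq_lintegral_ofReal (iT.const_mul _) (ae0.mono fun x hx => mul_nonneg hΓ.le (Rr x hx).1)] at step2
  rw [integral_const_mul, integral_const_mul, integral_const_mul] at step2
  have Tnn : 0 ≤ ∫ x, T x := integral_nonneg_of_ae (ae0.mono fun x hx => (Rr x hx).1)
  rw [ENNReal.ofReal_le_ofReal_iff (mul_nonneg hΓ.le Tnn)] at step2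
  have step3 := le_of_mul_le_mul_left step2 hΓ
  have eT : ∫ x, T x = (∫ x, ∑ j : Fin n, ‖fderiv ℝ f x (EuclideanSpace.single j 1)‖ ^ 2) + 
      n * (∫ x, (‖x‖^2)⁻¹ * inner ℝ (f x) (fderiv ℝ f x x)) + (n:ℝ)^2 / 4 * ∫ x, ((‖x‖^2)⁻¹ * ‖f x‖^2) := by
    rw [← integral_const_mul, ← integral_const_mul, ← integral_add iD (iJ.const_mul _), ← integral_add _ (iA.const_mul _)]
    exact iD.add (iJ.const_mul _)
  have eI : ∀ x : EuclideanSpace ℝ (Fin n), (2 * inner ℝ (f x) (fderiv ℝ f x x) + ((n:ℝ) - 2) * ‖f x‖ ^ 2) * (‖x‖ ^ 2)⁻¹ = 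
     2 * ((‖x‖^2)⁻¹ * inner ℝ (f x) (fderiv ℝ f x x)) + ((n:ℝ) - 2) * ((‖x‖^2)⁻¹ * ‖f x‖^2) := fun x => by ring
  have hibp := lbn_ibp n hn f hf hsupp (by simp only [eI]; exact (iJ.const_mul _).add (iA.const_mul _))
  simp only [eI] at hibp
  rw [integral_add (iJ.const_mul _) (iA.const_mul _), integral_const_mul, integral_const_mul] at hibp
  rw [eT] at step3
  set A := ∫ x, ((‖x‖^2)⁻¹ * ‖f x‖^2)
  set J := ∫ x, (‖x‖^2)⁻¹ * inner ℝ (f x) (fderiv ℝ f x x)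
  have hJ : J = -(((n:ℝ) - 2) * A) / 2 := by linarith
  rw [hJ] at step3
  linarith

/-- Let `n ≥ 3`, `ν > 0`, and `V : ℝⁿ → ℝ` measurable with
`|x|² V(x) ≥ -n²/4 + ν` a.e.  Then for every `f ∈ C₀^∞(ℝⁿ)` with `P f = 0`
(`f` orthogonal to radial functions), one has
`∫ (|∇f|² + V |f|²) dx ≥ ν ∫ |x|⁻² |f|² dx`. -/
theorem lower_bound_nonradial (n : ℕ) (hn : 3 ≤ n) (ν : ℝ) (hν : 0 < ν)
    (V : EuclideanSpace ℝ (Fin n) → ℝ) (hV : Measurable V)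
    (hVlb : ∀ᵐ x : EuclideanSpace ℝ (Fin n),
      -(n : ℝ) ^ 2 / 4 + ν ≤ ‖x‖ ^ 2 * V x)
    (f : EuclideanSpace ℝ (Fin n) → ℂ)
    (hf : ContDiff ℝ (⊤ : ℕ∞) f) (hsupp : HasCompactSupport f)
    (hrad : ∀ x, sphericalAvg n f x = 0)
    (hint : Integrable (fun x => V x * ‖f x‖ ^ 2)) :
    ν * ∫ x : EuclideanSpace ℝ (Fin n), (‖x‖ ^ 2)⁻¹ * ‖f x‖ ^ 2 ≤
      ∫ x : EuclideanSpace ℝ (Fin n),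
        ((∑ j : Fin n, ‖fderiv ℝ f x (EuclideanSpace.single j 1)‖ ^ 2) +
          V x * ‖f x‖ ^ 2) := by
  have hf1 : ContDiff ℝ 1 f := hf.of_le (by exact_mod_cast le_top)
  have : Nonempty (Fin n) := ⟨⟨0, by omega⟩⟩
  obtain ⟨iA, -, iD⟩ := lbn_integrable_f n hn f hf1 hsupp
  have hardy := lbn_hardy n hn f hf1 hsupp hrad
  rw [integral_add iD hint]
  have ae0 : ∀ᵐ x : EuclideanSpace ℝ (Fin n), x ≠ 0 :=
    Measure.ae_ne (volume : Measure (EuclideanSpace ℝ (Fin n))) 0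
  have hv : ∫ x : EuclideanSpace ℝ (Fin n), (-(n : ℝ) ^ 2 / 4 + ν) * ((‖x‖ ^ 2)⁻¹ * ‖f x‖ ^ 2) ≤
      ∫ x : EuclideanSpace ℝ (Fin n), V x * ‖f x‖ ^ 2 := by
    refine integral_mono_ae (iA.const_mul _) hint ?_
    filter_upwards [ae0, hVlb] with x hx h
    have hN : 0 < ‖x‖ ^ 2 := by have := norm_pos_iff.2 hx; positivity
    have h2 : (-(n : ℝ) ^ 2 / 4 + ν) * (‖x‖ ^ 2)⁻¹ ≤ V x := by
      rw [← div_eq_mul_inv, div_le_iff₀ hN]; linarith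
    rw [← mul_assoc]
    gcongr
  rw [integral_const_mul] at hv
  linarith
end
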